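/- arXiv:1008.4500 — 13 statements merged into one kernel-verified Lean document; each statement's English description precedes it below -/
import Mathlib

section
/- Let φ : ℤ → Aut(ℤ²) be the homomorphism with φ(1) given by the matrix [[2,1],[1,1]], and let G = ℤ² ⋊_φ ℤ be the corresponding semidirect product. Then G is not virtually nilpotent: G has no nilpotent subgroup of finite index. -/
/-- The automorphism of `ℤ²` given by the matrix `[[2,1],[1,1]]` (acting by
matrix-vector multiplication). -/
def matA : (Fin 2 → ℤ) ≃+ (Fin 2 → ℤ) where
  toFun v := ![2 * v 0 + v 1, v 0 + v 1]
  invFun w := ![w 0 - w 1, -w 0 + 2 * w 1]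
  left_inv v := by
    funext i
    fin_cases i <;> simp <;> ring
  right_inv w := by
    funext i
    fin_cases i <;> simp <;> ring
  map_add' v w := by
    funext i
    fin_cases i <;> simp [Pi.add_apply] <;> ring

/-- The homomorphism `φ : ℤ → Aut(ℤ²)` with `φ(1)` the matrix `[[2,1],[1,1]]`
(written multiplicatively so as to feed it to `SemidirectProduct`). -/
def phiA : Multiplicative ℤ →* MulAut (Multiplicative (Fin 2 → ℤ)) :=
  zpowersHom _ (AddEquiv.toMultiplicative matA)

/-- A Lyapunov function for `matA`: it strictly increases along nonzero orbits. -/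
def lyapunovA (v : Fin 2 → ℤ) : ℤ := v 0 ^ 2 + 4 * v 0 * v 1 - v 1 ^ 2

theorem lyapunovA_lt_matA {v : Fin 2 → ℤ} (hv : v ≠ 0) : lyapunovA v < lyapunovA (matA v) := by
  have key : lyapunovA (matA v) = lyapunovA v + 5 * (v 0 ^ 2 + (v 0 + v 1) ^ 2) := by
    simp only [lyapunovA, matA, AddEquiv.coe_mk, Equiv.coe_fn_mk, Matrix.cons_val_zero,
      Matrix.cons_val_one]
    ring
  have pos : 0 < v 0 ^ 2 + (v 0 + v 1) ^ 2 := by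
    by_contra! h
    have h0 : v 0 = 0 := by nlinarith [sq_nonneg (v 0), sq_nonneg (v 0 + v 1)]
    have h1 : v 1 = 0 := by
      rw [h0] at h
      nlinarith [sq_nonneg (v 1)]
    apply hv
    funext i
    fin_cases i <;> assumption
  omega

theorem lyapunovA_lt_iterate_matA {v : Fin 2 → ℤ} (hv : v ≠ 0) (n : ℕ) :
    lyapunovA v < lyapunovA (matA^[n + 1] v) := by
  induction n with
  | zero => exact lyapunovA_lt_matA hv
  | succ n ih =>
    rw [Function.iterate_succ_apply']
    refine ih.trans (lyapunovA_lt_matA fun h => hv ?_)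
    exact matA.injective.iterate (n + 1) (h.trans (iterate_map_zero matA _).symm)

theorem phiA_pow_apply (n : ℕ) (x : Multiplicative (Fin 2 → ℤ)) :
    phiA (Multiplicative.ofAdd 1 ^ n) x = Multiplicative.ofAdd (matA^[n] x.toAdd) := by
  induction n with
  | zero => simp
  | succ n ih =>
    rw [pow_succ', map_mul, MulAut.mul_apply, ih, Function.iterate_succ_apply']
    simp [phiA]

theorem phiA_pow_apply_ne_self {n : ℕ} (hn : n ≠ 0) {x : Multiplicative (Fin 2 → ℤ)}
    (hx : x ≠ 1) : phiA (Multiplicative.ofAdd 1 ^ n) x ≠ x := by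
  obtain ⟨m, rfl⟩ := Nat.exists_eq_succ_of_ne_zero hn
  intro h
  rw [phiA_pow_apply] at h
  have hlt := lyapunovA_lt_iterate_matA (v := x.toAdd) hx m
  exact hlt.ne (congrArg (fun y => lyapunovA y.toAdd) h).symm

open scoped commutatorElement in
/-- If a subgroup of a semidirect product contains some `inr g` whose action has no nontrivial
fixed points, and meets the normal factor nontrivially, then its lower central series never
vanishes. -/
theorem SemidirectProduct.exists_inl_mem_lowerCentralSeries {N G : Type*} [Group N] [Group G]
    {φ : G →* MulAut N} {H : Subgroup (N ⋊[φ] G)} {g : G} (hg : (inr g : N ⋊[φ] G) ∈ H)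
    (hfix : ∀ x : N, x ≠ 1 → φ g x ≠ x) {x : N} (hx : x ≠ 1)
    (hxH : (inl x : N ⋊[φ] G) ∈ H) (n : ℕ) :
    ∃ y : N, y ≠ 1 ∧ (inl y : N ⋊[φ] G) ∈ H.lowerCentralSeries n := by
  induction n with
  | zero => exact ⟨x, hx, hxH⟩
  | succ n ih =>
    obtain ⟨y, hy, hyn⟩ := ih
    refine ⟨y * (φ g y)⁻¹, fun h => hfix y hy (mul_inv_eq_one.mp h).symm, ?_⟩
    have : (inl (y * (φ g y)⁻¹) : N ⋊[φ] G) = ⁅(inl y : N ⋊[φ] G), inr g⁆ := by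
      rw [map_mul, map_inv, inl_aut, commutatorElement_def]
      simp [mul_assoc]
    rw [this]
    exact Subgroup.commutator_mem_commutator hyn hg

/-- The semidirect product `G = ℤ² ⋊_φ ℤ`, where `φ(1)` acts as the matrix
`[[2,1],[1,1]]`, is not virtually nilpotent: it has no nilpotent subgroup of finite index. -/
theorem semidirect_not_virtually_nilpotent :
    ¬ ∃ H : Subgroup (Multiplicative (Fin 2 → ℤ) ⋊[phiA] Multiplicative ℤ),
        H.FiniteIndex ∧ Group.IsNilpotent H := by
  rintro ⟨H, hfin, hnil⟩
  obtain ⟨n, hn, -, hnH⟩ := Subgroup.exists_pow_mem_of_index_ne_zero hfin.index_ne_zero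
    (SemidirectProduct.inr (Multiplicative.ofAdd 1))
  obtain ⟨m, hm, -, hmH⟩ := Subgroup.exists_pow_mem_of_index_ne_zero hfin.index_ne_zero
    (SemidirectProduct.inl (Multiplicative.ofAdd fun _ => 1))
  rw [← map_pow] at hnH hmH
  have hne : (Multiplicative.ofAdd fun _ : Fin 2 => (1 : ℤ)) ^ m ≠ 1 := by
    intro h
    have h0 := congrFun (congrArg Multiplicative.toAdd h) 0
    simp at h0
    omega
  obtain ⟨k, hk⟩ := H.isNilpotent_iff_lowerCentralSeries.mp hnil
  obtain ⟨y, hy, hyk⟩ := SemidirectProduct.exists_inl_mem_lowerCentralSeries hnH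
    (fun _ => phiA_pow_apply_ne_self hn.ne') hne hmH k
  rw [hk, Subgroup.mem_bot] at hyk
  exact hy (SemidirectProduct.inl_injective (hyk.trans (map_one _).symm))
end

section
/- Let N be a group and F a subgroup of MulAut(N). Let φ be a group automorphism of the subgroup N⋊F of Aff(N) such that φ(N) = N and φ(F) = F, and let ψ ∈ MulAut(N) denote the restriction of φ to N. Then for every x ∈ N⋊F one has φ(x) = ψ x ψ⁻¹, where the conjugation takes place in the group Aff(N). (Lemma 3.1 of the paper; in the Lie-group setting the hypothesis φ(N) = N is automatic since N is the identity component of N⋊F.) -/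
open SemidirectProduct

/-- For a group `N`, `Aff(N) := N ⋊ MulAut(N)`, the semidirect product for the natural
action of `MulAut N` on `N`. -/
abbrev AffG (N : Type*) [Group N] := N ⋊[MonoidHom.id (MulAut N)] MulAut N

/-- For a subgroup `F ≤ MulAut N`, `N⋊F` is the subgroup of `Aff(N)` generated by
(the canonical images of) `N` and `F`. -/
def NF {N : Type*} [Group N] (F : Subgroup (MulAut N)) : Subgroup (AffG N) :=
  Subgroup.closure
    (Set.range (inl : N →* AffG N) ∪ (inr : MulAut N →* AffG N) '' (F : Set (MulAut N)))

theorem inl_mem_NF {N : Type*} [Group N] (F : Subgroup (MulAut N)) (m : N) :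
    (inl m : AffG N) ∈ NF F :=
  Subgroup.subset_closure (Or.inl ⟨m, rfl⟩)

/-- An automorphism of `N⋊F` preserving `N` and `F` acts on the elements of `F` as conjugation
by its restriction to `N`. -/
theorem coe_map_eq_conj_of_left_eq_one {N : Type*} [Group N] (F : Subgroup (MulAut N))
    (φ : ↥(NF F) ≃* ↥(NF F)) (ψ : MulAut N)
    (hψ : ∀ m : N, φ ⟨inl m, inl_mem_NF F m⟩ = ⟨inl (ψ m), inl_mem_NF F (ψ m)⟩)
    (y : ↥(NF F)) (hy : (y : AffG N).left = 1) (hφy : (φ y : AffG N).left = 1) :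
    (φ y : AffG N) = inr ψ * (y : AffG N) * (inr ψ)⁻¹ := by
  have comm (n : N) : (φ y : AffG N).right (ψ n) = ψ ((y : AffG N).right n) := by
    have h : y * ⟨inl n, inl_mem_NF F n⟩ =
        ⟨inl ((y : AffG N).right n), inl_mem_NF F _⟩ * y := by
      apply Subtype.ext
      ext <;> simp [hy]
    have h' := congrArg (fun z : ↥(NF F) => (z : AffG N).left) (congrArg φ h)
    simpa [hψ, hφy] using h'
  apply SemidirectProduct.ext
  · simp [hy, hφy]
  · ext n
    simpa using comm (ψ⁻¹ n)

/-- Lemma 3.1 of the paper. Let `N` be a group and `F ≤ MulAut N`.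
Let `φ` be an automorphism of the subgroup `N⋊F` of `Aff(N)` with `φ(N) = N` and
`φ(F) = F`, and let `ψ ∈ MulAut N` be the restriction of `φ` to `N`. Then
`φ(x) = ψ x ψ⁻¹` for every `x ∈ N⋊F`, conjugation taking place in `Aff(N)`. -/
theorem automorphism_of_NF_is_conjugation {N : Type*} [Group N] (F : Subgroup (MulAut N))
    (φ : ↥(NF F) ≃* ↥(NF F)) (ψ : MulAut N)
    (hψ : ∀ m : N, φ ⟨inl m, inl_mem_NF F m⟩ = ⟨inl (ψ m), inl_mem_NF F (ψ m)⟩)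
    (hF : ∀ x : ↥(NF F), (x : AffG N).left = 1 ↔ ((φ x : ↥(NF F)) : AffG N).left = 1) :
    ∀ x : ↥(NF F),
      ((φ x : ↥(NF F)) : AffG N) = inr ψ * (x : AffG N) * (inr ψ)⁻¹ := by
  intro x
  obtain ⟨y, hxy, hy⟩ : ∃ y : ↥(NF F),
      x = ⟨inl (x : AffG N).left, inl_mem_NF F _⟩ * y ∧ (y : AffG N).left = 1 :=
    ⟨⟨inl (x : AffG N).left, inl_mem_NF F _⟩⁻¹ * x, by simp, by simp⟩
  rw [hxy, map_mul, hψ, Subgroup.coe_mul, Subgroup.coe_mul,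
    coe_map_eq_conj_of_left_eq_one F φ ψ hψ y hy ((hF y).1 hy)]
  have h := inl_aut (φ := MonoidHom.id (MulAut N)) ψ (x : AffG N).left
  simp only [MonoidHom.id_apply] at h
  simp only [h, map_inv]
  group
end

section
/- Let N be a group, F a finite subgroup of MulAut(N), and Γ a subgroup of N⋊F with p(Γ) = F. Let φ ∈ MulAut(N) and suppose that φ γ φ⁻¹ ∈ Γ for every γ ∈ Γ (conjugation in Aff(N)). Then conjugation by φ maps the subgroup N⋊F of Aff(N) onto itself and maps F onto F; in particular x ↦ φ x φ⁻¹ restricts to an automorphism Φ of N⋊F with Φ(F) = F, Φ(N) = N and Φ(Γ) ⊆ Γ. (Algebraic core of Theorem 3.4 of the paper.) -/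
open SemidirectProduct

theorem Subgroup.map_conj_eq_of_finite {G : Type*} [Group G] {H : Subgroup G} (hH : Finite H)
    {g : G} (h : H.map (MulAut.conj g).toMonoidHom ≤ H) :
    H.map (MulAut.conj g).toMonoidHom = H :=
  Subgroup.eq_of_le_of_card_ge h
    (Subgroup.card_map_of_injective (MulAut.conj g).injective).ge

theorem NF_eq_sup {N : Type*} [Group N] (F : Subgroup (MulAut N)) :
    NF F = (inl : N →* AffG N).range ⊔ F.map (inr : MulAut N →* AffG N) := by
  rw [NF, Subgroup.closure_union, ← MonoidHom.coe_range, ← Subgroup.coe_map,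
    Subgroup.closure_eq, Subgroup.closure_eq]

theorem map_conj_inr_range_inl {N : Type*} [Group N] (φ : MulAut N) :
    ((inl : N →* AffG N).range).map (MulAut.conj (inr φ : AffG N)).toMonoidHom =
      (inl : N →* AffG N).range := by
  rw [SemidirectProduct.range_inl_eq_ker_rightHom]
  exact Subgroup.Normal.map_conj_eq _ _

theorem map_conj_inr_map_inr {N : Type*} [Group N] (F : Subgroup (MulAut N)) (φ : MulAut N) :
    (F.map (inr : MulAut N →* AffG N)).map (MulAut.conj (inr φ : AffG N)).toMonoidHom =
      (F.map (MulAut.conj φ).toMonoidHom).map (inr : MulAut N →* AffG N) := by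
  rw [Subgroup.map_map, Subgroup.map_map]
  congr 1
  ext1 f
  simp

/-- algebraic core of Theorem 3.4 of the paper. Let `N` be a group,
`F` a finite subgroup of `MulAut N`, and `Γ ≤ N⋊F` with `p(Γ) = F`. Let `φ ∈ MulAut N`
with `φγφ⁻¹ ∈ Γ` for all `γ ∈ Γ` (conjugation in `Aff(N)`). Then conjugation by `φ` maps
`N⋊F` onto itself, maps `F` onto `F`, maps `N` onto `N`, and maps `Γ` into `Γ`. -/
theorem conjugation_restricts_to_NF {N : Type*} [Group N] (F : Subgroup (MulAut N))
    (hFfin : Finite F) (Γ : Subgroup (AffG N)) (hΓ : Γ ≤ NF F)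
    (hp : Γ.map (rightHom : AffG N →* MulAut N) = F) (φ : MulAut N)
    (hconj : ∀ γ ∈ Γ, (inr φ : AffG N) * γ * (inr φ)⁻¹ ∈ Γ) :
    (NF F).map (MulAut.conj (inr φ : AffG N)).toMonoidHom = NF F ∧
    (F.map (inr : MulAut N →* AffG N)).map (MulAut.conj (inr φ : AffG N)).toMonoidHom =
      F.map (inr : MulAut N →* AffG N) ∧
    ((inl : N →* AffG N).range).map (MulAut.conj (inr φ : AffG N)).toMonoidHom =
      (inl : N →* AffG N).range ∧
    Γ.map (MulAut.conj (inr φ : AffG N)).toMonoidHom ≤ Γ := by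
  have hF : F.map (MulAut.conj φ).toMonoidHom = F := by
    refine Subgroup.map_conj_eq_of_finite hFfin ?_
    rintro _ ⟨f, hf, rfl⟩
    rw [← hp] at hf ⊢
    obtain ⟨γ, hγ, rfl⟩ := hf
    exact ⟨_, hconj γ hγ, by simp⟩
  have hinr := (map_conj_inr_map_inr F φ).trans (by rw [hF])
  refine ⟨?_, hinr, map_conj_inr_range_inl φ, ?_⟩
  · rw [NF_eq_sup, Subgroup.map_sup, map_conj_inr_range_inl, hinr]
  · rintro _ ⟨γ, hγ, rfl⟩
    exact hconj γ hγ
end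

section
/- Let N be a group and Γ a subgroup of Aff(N) such that p(Γ) is finite. Let α ∈ Aff(N) with αΓα⁻¹ ⊆ Γ. Then p(αΓα⁻¹) = p(Γ), and conjugation by α maps the subgroup N⋊p(Γ) of Aff(N) onto itself (and maps N onto N). (Algebraic form of Corollary 2.3 of the paper, the repair of Auslander's false theorem: here α plays the role of the affine map realizing a monomorphism ψ : Γ → Γ.) -/
open SemidirectProduct

theorem NF_eq_comap_rightHom {N : Type*} [Group N] (F : Subgroup (MulAut N)) :
    NF F = F.comap (rightHom : AffG N →* MulAut N) := by
  apply le_antisymm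
  · rw [NF, Subgroup.closure_le]
    rintro _ (⟨n, rfl⟩ | ⟨f, hf, rfl⟩)
    · simp
    · simpa using hf
  · intro x hx
    rw [← inl_left_mul_inr_right x]
    exact mul_mem (Subgroup.subset_closure (Or.inl ⟨x.left, rfl⟩))
      (Subgroup.subset_closure (Or.inr ⟨x.right, hx, rfl⟩))

theorem Subgroup.map_conj_map {G H : Type*} [Group G] [Group H] (f : G →* H) (K : Subgroup G)
    (a : G) :
    (K.map (MulAut.conj a).toMonoidHom).map f =
      (K.map f).map (MulAut.conj (f a)).toMonoidHom := by
  rw [Subgroup.map_map, Subgroup.map_map]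
  congr 1
  ext x
  simp

theorem Subgroup.map_conj_comap {G H : Type*} [Group G] [Group H] (f : G →* H) (K : Subgroup H)
    (a : G) :
    (K.comap f).map (MulAut.conj a).toMonoidHom =
      (K.map (MulAut.conj (f a)).toMonoidHom).comap f := by
  ext x
  constructor
  · rintro ⟨y, hy, rfl⟩
    exact ⟨f y, hy, by simp⟩
  · rintro ⟨y, hy, hyx⟩
    have hy_eq : f (a⁻¹ * x * a) = y := by
      simp only [map_mul, map_inv, ← hyx]
      simp [mul_assoc]
    exact ⟨a⁻¹ * x * a, Subgroup.mem_comap.2 (hy_eq ▸ hy), by simp [mul_assoc]⟩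

theorem Subgroup.map_eq_of_map_le_of_finite {G : Type*} [Group G] (K : Subgroup G) [Finite K]
    (e : G ≃* G) (h : K.map e.toMonoidHom ≤ K) : K.map e.toMonoidHom = K :=
  Subgroup.eq_of_le_of_card_ge h
    (Nat.card_congr (K.equivMapOfInjective e.toMonoidHom e.injective).toEquiv).le

/-- algebraic form of Corollary 2.3 of the paper, repairing Auslander's
false theorem. Let `N` be a group and `Γ ≤ Aff(N)` with `p(Γ)` finite. Let `α ∈ Aff(N)`
with `αΓα⁻¹ ⊆ Γ`. Then `p(αΓα⁻¹) = p(Γ)`, and conjugation by `α` maps the subgroup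
`N⋊p(Γ)` of `Aff(N)` onto itself, and maps `N` onto `N`. -/
theorem conjugation_preserves_NpGamma {N : Type*} [Group N] (Γ : Subgroup (AffG N))
    (hfin : Finite (Γ.map (rightHom : AffG N →* MulAut N)))
    (α : AffG N) (hconj : ∀ γ ∈ Γ, α * γ * α⁻¹ ∈ Γ) :
    (Γ.map (MulAut.conj α).toMonoidHom).map (rightHom : AffG N →* MulAut N) =
      Γ.map (rightHom : AffG N →* MulAut N) ∧
    (NF (Γ.map (rightHom : AffG N →* MulAut N))).map (MulAut.conj α).toMonoidHom =
      NF (Γ.map (rightHom : AffG N →* MulAut N)) ∧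
    ((inl : N →* AffG N).range).map (MulAut.conj α).toMonoidHom =
      (inl : N →* AffG N).range := by
  have hle : (Γ.map (MulAut.conj α).toMonoidHom).map (rightHom : AffG N →* MulAut N) ≤
      Γ.map rightHom := by
    refine Subgroup.map_mono ?_
    rintro _ ⟨γ, hγ, rfl⟩
    exact hconj γ hγ
  have heq := Subgroup.map_eq_of_map_le_of_finite _ _
    ((Subgroup.map_conj_map (rightHom : AffG N →* MulAut N) Γ α).symm.trans_le hle)
  refine ⟨(Subgroup.map_conj_map _ Γ α).trans heq, ?_, ?_⟩
  · rw [NF_eq_comap_rightHom, Subgroup.map_conj_comap, heq]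
  · rw [range_inl_eq_ker_rightHom, ← MonoidHom.comap_bot, Subgroup.map_conj_comap,
      Subgroup.map_bot]
end

section
/- Conjugation by D maps the Hantzsche–Wendt group Γ into itself: D(z,I₃)D⁻¹ = (δ·z, I₃) for every z ∈ ℤ³, D·A·D⁻¹ = A, and D·B·D⁻¹ = ((0,1,1), I₃)·A·B, so DΓD⁻¹ ⊆ Γ. Moreover, conjugation by D maps the subgroup of Aff(ℝ³) generated by all translations {(v,I₃) : v ∈ ℝ³} and {(0,μ) : μ ∈ F} onto itself, but it does NOT map the subgroup {(0,μ) : μ ∈ F} into itself (e.g. D·(0,β₀)·D⁻¹ = ((1/2,0,0), α₀β₀)). -/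
/-- The affine group `Aff(ℝⁿ) = ℝⁿ ⋊ GLₙ(ℝ)`: pairs `(v, M)` with multiplication
`(v, M) * (w, N) = (v + M·w, M·N)`. -/
@[ext] structure AffR (n : ℕ) where
  v : Fin n → ℝ
  m : GL (Fin n) ℝ

namespace AffR

variable {n : ℕ}

instance : Mul (AffR n) := ⟨fun x y => ⟨x.v + x.m.val.mulVec y.v, x.m * y.m⟩⟩
instance : One (AffR n) := ⟨⟨0, 1⟩⟩
instance : Inv (AffR n) := ⟨fun x => ⟨-((x.m⁻¹).val.mulVec x.v), x.m⁻¹⟩⟩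

@[simp] theorem mul_v (x y : AffR n) : (x * y).v = x.v + x.m.val.mulVec y.v := rfl
@[simp] theorem mul_m (x y : AffR n) : (x * y).m = x.m * y.m := rfl
@[simp] theorem one_v : (1 : AffR n).v = 0 := rfl
@[simp] theorem one_m : (1 : AffR n).m = 1 := rfl
@[simp] theorem inv_v (x : AffR n) : (x⁻¹).v = -((x.m⁻¹).val.mulVec x.v) := rfl
@[simp] theorem inv_m (x : AffR n) : (x⁻¹).m = x.m⁻¹ := rfl

instance : Group (AffR n) where
  mul_assoc x y z := by
    ext <;> simp [Matrix.mulVec_add, Matrix.mulVec_mulVec, add_assoc, mul_assoc]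
  one_mul x := by ext <;> simp
  mul_one x := by ext <;> simp
  inv_mul_cancel x := by ext <;> simp

/-- The natural affine action of `Aff(ℝⁿ)` on `ℝⁿ`: `(v, M) · x = v + M·x`. -/
def act (g : AffR n) (x : Fin n → ℝ) : Fin n → ℝ := g.v + g.m.val.mulVec x

/-- The translation by a vector `w`, i.e. the element `(w, I)` of `Aff(ℝⁿ)`. -/
def tr (w : Fin n → ℝ) : AffR n := ⟨w, 1⟩

end AffR

/-- `α₀ = diag(1,−1,−1)` as an element of `GL₃(ℝ)`. -/
noncomputable def alpha0 : GL (Fin 3) ℝ :=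
  ⟨!![1,0,0; 0,-1,0; 0,0,-1], !![1,0,0; 0,-1,0; 0,0,-1],
    by rw [Matrix.mul_fin_three, Matrix.one_fin_three]; norm_num,
    by rw [Matrix.mul_fin_three, Matrix.one_fin_three]; norm_num⟩

/-- `β₀ = diag(−1,1,−1)` as an element of `GL₃(ℝ)`. -/
noncomputable def beta0 : GL (Fin 3) ℝ :=
  ⟨!![-1,0,0; 0,1,0; 0,0,-1], !![-1,0,0; 0,1,0; 0,0,-1],
    by rw [Matrix.mul_fin_three, Matrix.one_fin_three]; norm_num,
    by rw [Matrix.mul_fin_three, Matrix.one_fin_three]; norm_num⟩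

/-- `δ`, the permutation matrix interchanging the 2nd and 3rd coordinates,
as an element of `GL₃(ℝ)`. -/
noncomputable def deltaP : GL (Fin 3) ℝ :=
  ⟨!![1,0,0; 0,0,1; 0,1,0], !![1,0,0; 0,0,1; 0,1,0],
    by rw [Matrix.mul_fin_three, Matrix.one_fin_three]; norm_num,
    by rw [Matrix.mul_fin_three, Matrix.one_fin_three]; norm_num⟩

/-- `A = ((1/2,0,0), α₀) ∈ Aff(ℝ³)`. -/
noncomputable def Ael : AffR 3 := ⟨![1/2, 0, 0], alpha0⟩

/-- `B = ((0,1/2,1/2), β₀) ∈ Aff(ℝ³)`. -/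
noncomputable def Bel : AffR 3 := ⟨![0, 1/2, 1/2], beta0⟩

/-- `D = ((1/4,0,0), δ) ∈ Aff(ℝ³)`. -/
noncomputable def Del : AffR 3 := ⟨![1/4, 0, 0], deltaP⟩

/-- The Hantzsche–Wendt group `Γ`: the subgroup of `Aff(ℝ³)` generated by the integer
translations together with `A` and `B`. -/
noncomputable def GammaHW : Subgroup (AffR 3) :=
  Subgroup.closure
    ({x : AffR 3 | ∃ z : Fin 3 → ℤ, x = AffR.tr fun i => (z i : ℝ)} ∪ {Ael, Bel})

/-- The set `{(0,μ) : μ ∈ F}` in `Aff(ℝ³)`, where `F = {I₃, α₀, β₀, α₀β₀}`. -/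
noncomputable def FSet : Set (AffR 3) :=
  {(⟨0, 1⟩ : AffR 3), ⟨0, alpha0⟩, ⟨0, beta0⟩, ⟨0, alpha0 * beta0⟩}

/-- The subgroup `ℝ³⋊F` of `Aff(ℝ³)`: the subgroup generated by all translations
`{(v,I₃) : v ∈ ℝ³}` together with `{(0,μ) : μ ∈ F}`. -/
noncomputable def R3F : Subgroup (AffR 3) :=
  Subgroup.closure ({x : AffR 3 | x.m = 1} ∪ FSet)

theorem deltaP_mul_alpha0 : deltaP * alpha0 = alpha0 * deltaP := by
  ext i j
  fin_cases i <;> fin_cases j <;> simp [deltaP, alpha0, Matrix.mul_apply, Fin.sum_univ_three]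

theorem deltaP_mul_beta0 : deltaP * beta0 = alpha0 * beta0 * deltaP := by
  ext i j
  fin_cases i <;> fin_cases j <;>
    simp [deltaP, alpha0, beta0, Matrix.mul_apply, Fin.sum_univ_three]

theorem alpha0_mul_self : alpha0 * alpha0 = 1 := by
  ext i j
  fin_cases i <;> fin_cases j <;> simp [alpha0, Matrix.mul_apply, Fin.sum_univ_three]

theorem deltaP_mul_self : deltaP * deltaP = 1 := by
  ext i j
  fin_cases i <;> fin_cases j <;> simp [deltaP, Matrix.mul_apply, Fin.sum_univ_three]

theorem conj_Del_tr (w : Fin 3 → ℝ) :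
    Del * AffR.tr w * Del⁻¹ = AffR.tr (deltaP.val.mulVec w) := by
  rw [mul_inv_eq_iff_eq_mul]
  refine AffR.ext ?_ ?_ <;> simp [Del, AffR.tr, add_comm]

theorem conj_Del_Ael : Del * Ael * Del⁻¹ = Ael := by
  rw [mul_inv_eq_iff_eq_mul]
  refine AffR.ext ?_ deltaP_mul_alpha0
  ext i
  fin_cases i <;> simp [Del, Ael, deltaP, alpha0]
  norm_num

theorem conj_Del_Bel : Del * Bel * Del⁻¹ = AffR.tr ![0, 1, 1] * Ael * Bel := by
  rw [mul_inv_eq_iff_eq_mul]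
  refine AffR.ext ?_ ?_
  · ext i
    fin_cases i <;>
      simp [Del, Ael, Bel, AffR.tr, deltaP, alpha0, beta0, Matrix.vecHead, Matrix.vecTail] <;>
      norm_num
  · simpa [AffR.tr, Del, Ael, Bel] using deltaP_mul_beta0

theorem conj_Del_beta0 :
    Del * (⟨0, beta0⟩ : AffR 3) * Del⁻¹ = ⟨![1/2, 0, 0], alpha0 * beta0⟩ := by
  rw [mul_inv_eq_iff_eq_mul]
  refine AffR.ext ?_ deltaP_mul_beta0
  ext i
  fin_cases i <;> simp [Del, deltaP, alpha0, beta0]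
  norm_num

theorem conj_Del_beta0_notMem_FSet : Del * (⟨0, beta0⟩ : AffR 3) * Del⁻¹ ∉ FSet := by
  have v_eq_zero : ∀ x ∈ FSet, x.v = 0 := by
    rintro x (rfl | rfl | rfl | rfl) <;> rfl
  intro h
  have h0 := congrFun (v_eq_zero _ h) 0
  rw [conj_Del_beta0] at h0
  norm_num at h0

theorem tr_int_mem_GammaHW (z : Fin 3 → ℤ) : AffR.tr (fun i => (z i : ℝ)) ∈ GammaHW :=
  Subgroup.subset_closure (.inl ⟨z, rfl⟩)

theorem Ael_mem_GammaHW : Ael ∈ GammaHW :=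
  Subgroup.subset_closure (.inr (.inl rfl))

theorem Bel_mem_GammaHW : Bel ∈ GammaHW :=
  Subgroup.subset_closure (.inr (.inr rfl))

theorem conj_Del_mem_GammaHW {γ : AffR 3} (hγ : γ ∈ GammaHW) : Del * γ * Del⁻¹ ∈ GammaHW := by
  suffices GammaHW ≤ GammaHW.comap (MulAut.conj Del).toMonoidHom from this hγ
  refine (Subgroup.closure_le _).2 ?_
  rintro x (⟨z, rfl⟩ | rfl | rfl)
  · change Del * _ * Del⁻¹ ∈ GammaHW
    rw [conj_Del_tr]
    convert tr_int_mem_GammaHW ![z 0, z 2, z 1] using 2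
    ext i
    fin_cases i <;> simp [deltaP, Matrix.mulVec, dotProduct, Fin.sum_univ_three]
  · change Del * _ * Del⁻¹ ∈ GammaHW
    rw [conj_Del_Ael]
    exact Ael_mem_GammaHW
  · change Del * _ * Del⁻¹ ∈ GammaHW
    rw [conj_Del_Bel]
    refine mul_mem (mul_mem ?_ Ael_mem_GammaHW) Bel_mem_GammaHW
    convert tr_int_mem_GammaHW ![0, 1, 1] using 2
    ext i
    fin_cases i <;> simp

theorem mem_R3F_of_linear_part {x : AffR 3} (h : (⟨0, x.m⟩ : AffR 3) ∈ FSet) : x ∈ R3F := by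
  have hx : x = AffR.tr x.v * ⟨0, x.m⟩ := by
    refine AffR.ext ?_ ?_ <;> simp [AffR.tr]
  rw [hx]
  exact mul_mem (Subgroup.subset_closure (.inl rfl)) (Subgroup.subset_closure (.inr h))

theorem conj_Del_mem_R3F {x : AffR 3} (hx : x ∈ R3F) : Del * x * Del⁻¹ ∈ R3F := by
  suffices R3F ≤ R3F.comap (MulAut.conj Del).toMonoidHom from this hx
  refine (Subgroup.closure_le _).2 fun y hy => mem_R3F_of_linear_part ?_
  have hm : (MulAut.conj Del y).m = deltaP * y.m * deltaP⁻¹ := rfl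
  change (⟨0, (MulAut.conj Del y).m⟩ : AffR 3) ∈ FSet
  rw [hm]
  rcases hy with (hy : y.m = 1) | rfl | rfl | rfl | rfl
  · left
    simp [hy]
  · left
    simp
  · right; left
    simp [deltaP_mul_alpha0]
  · right; right; right
    simp [deltaP_mul_beta0]
  · right; right; left
    have : deltaP * (alpha0 * beta0) = beta0 * deltaP := by
      rw [← mul_assoc, deltaP_mul_alpha0, mul_assoc, deltaP_mul_beta0, ← mul_assoc, ← mul_assoc,
        alpha0_mul_self, one_mul]
    simp [this]

theorem Del_mul_self_mem_R3F : Del * Del ∈ R3F :=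
  Subgroup.subset_closure (.inl deltaP_mul_self)

theorem map_conj_Del_R3F : R3F.map (MulAut.conj Del).toMonoidHom = R3F := by
  refine le_antisymm (Subgroup.map_le_iff_le_comap.2 fun x hx => conj_Del_mem_R3F hx) ?_
  intro x hx
  refine ⟨(Del * Del)⁻¹ * (Del * x * Del⁻¹) * (Del * Del), ?_, ?_⟩
  · exact mul_mem (mul_mem (inv_mem Del_mul_self_mem_R3F) (conj_Del_mem_R3F hx))
      Del_mul_self_mem_R3F
  · change Del * _ * Del⁻¹ = x
    group

/-- Conjugation by `D` maps the Hantzsche–Wendt group `Γ` into itself: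
`D(z,I₃)D⁻¹ = (δ·z, I₃)` for every `z ∈ ℤ³`, `D·A·D⁻¹ = A`, and
`D·B·D⁻¹ = ((0,1,1), I₃)·A·B`, so `DΓD⁻¹ ⊆ Γ`. Moreover, conjugation by `D` maps the
subgroup of `Aff(ℝ³)` generated by all translations and `{(0,μ) : μ ∈ F}` onto itself,
but it does NOT map `{(0,μ) : μ ∈ F}` into itself: `D·(0,β₀)·D⁻¹ = ((1/2,0,0), α₀β₀)`. -/
theorem conj_by_D_Hantzsche_Wendt :
    (∀ z : Fin 3 → ℤ,
      Del * AffR.tr (fun i => (z i : ℝ)) * Del⁻¹ =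
        AffR.tr (deltaP.val.mulVec fun i => (z i : ℝ))) ∧
    Del * Ael * Del⁻¹ = Ael ∧
    Del * Bel * Del⁻¹ = AffR.tr ![0, 1, 1] * Ael * Bel ∧
    (∀ γ ∈ GammaHW, Del * γ * Del⁻¹ ∈ GammaHW) ∧
    Subgroup.map (MulAut.conj Del).toMonoidHom R3F = R3F ∧
    (Del * (⟨0, beta0⟩ : AffR 3) * Del⁻¹ = (⟨![1/2, 0, 0], alpha0 * beta0⟩ : AffR 3) ∧
      ¬ (Del * (⟨0, beta0⟩ : AffR 3) * Del⁻¹ ∈ FSet)) := by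
  exact ⟨fun z => conj_Del_tr _, conj_Del_Ael, conj_Del_Bel, fun _ => conj_Del_mem_GammaHW,
    map_conj_Del_R3F, conj_Del_beta0, conj_Del_beta0_notMem_FSet⟩
end

section
/- For the Klein bottle group Γ ≤ Aff(ℝ²) and α = ((1/2,0), 3·I₂) ∈ Aff(ℝ²), one has α a α⁻¹ = a³ and α b α⁻¹ = a b³; consequently α Γ α⁻¹ ⊆ Γ. -/
/-- `diag(−1,1)` as an element of `GL₂(ℝ)`. -/
noncomputable def diagB : GL (Fin 2) ℝ :=
  ⟨!![-1,0; 0,1], !![-1,0; 0,1],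
    by rw [Matrix.mul_fin_two, Matrix.one_fin_two]; norm_num,
    by rw [Matrix.mul_fin_two, Matrix.one_fin_two]; norm_num⟩

/-- `3·I₂` as an element of `GL₂(ℝ)`. -/
noncomputable def threeI : GL (Fin 2) ℝ :=
  ⟨!![3,0; 0,3], !![1/3,0; 0,1/3],
    by rw [Matrix.mul_fin_two, Matrix.one_fin_two]; norm_num,
    by rw [Matrix.mul_fin_two, Matrix.one_fin_two]; norm_num⟩

/-- `a = ((1,0), I₂) ∈ Aff(ℝ²)`. -/
noncomputable def aK : AffR 2 := ⟨![1, 0], 1⟩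

/-- `b = ((0,1/2), diag(−1,1)) ∈ Aff(ℝ²)`. -/
noncomputable def bK : AffR 2 := ⟨![0, 1/2], diagB⟩

/-- The Klein bottle group `Γ ≤ Aff(ℝ²)`, generated by `a` and `b`. -/
noncomputable def GammaK : Subgroup (AffR 2) := Subgroup.closure {aK, bK}

/-- `α = ((1/2,0), 3·I₂) ∈ Aff(ℝ²)`. -/
noncomputable def alphaK : AffR 2 := ⟨![1/2, 0], threeI⟩

theorem alphaK_mul_aK : alphaK * aK = aK ^ 3 * alphaK := by
  ext i j
  · fin_cases i <;> simp [pow_succ, alphaK, aK, threeI]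
    norm_num
  · simp [pow_succ, alphaK, aK]

theorem alphaK_mul_bK : alphaK * bK = aK * bK ^ 3 * alphaK := by
  ext i j
  · fin_cases i <;>
      simp [pow_succ, alphaK, aK, bK, threeI, diagB, Matrix.vecHead, Matrix.vecTail] <;>
      norm_num
  · fin_cases i <;> fin_cases j <;>
      simp [pow_succ, alphaK, aK, bK, threeI, diagB]

/-- For the Klein bottle group `Γ ≤ Aff(ℝ²)` and
`α = ((1/2,0), 3·I₂) ∈ Aff(ℝ²)`, one has `α a α⁻¹ = a³` and `α b α⁻¹ = a b³`;
consequently `α Γ α⁻¹ ⊆ Γ`. -/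
theorem alpha_conj_klein :
    alphaK * aK * alphaK⁻¹ = aK ^ 3 ∧
    alphaK * bK * alphaK⁻¹ = aK * bK ^ 3 ∧
    ∀ γ ∈ GammaK, alphaK * γ * alphaK⁻¹ ∈ GammaK := by
  have ha : alphaK * aK * alphaK⁻¹ = aK ^ 3 := mul_inv_eq_of_eq_mul alphaK_mul_aK
  have hb : alphaK * bK * alphaK⁻¹ = aK * bK ^ 3 := mul_inv_eq_of_eq_mul alphaK_mul_bK
  refine ⟨ha, hb, ?_⟩
  have hle : GammaK ≤ GammaK.comap (MulAut.conj alphaK).toMonoidHom := by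
    have haΓ : aK ∈ GammaK := Subgroup.subset_closure (by simp)
    have hbΓ : bK ∈ GammaK := Subgroup.subset_closure (by simp)
    refine (Subgroup.closure_le _).mpr ?_
    rintro x (rfl | rfl)
    · change alphaK * aK * alphaK⁻¹ ∈ GammaK
      exact ha ▸ pow_mem haΓ 3
    · change alphaK * bK * alphaK⁻¹ ∈ GammaK
      exact hb ▸ mul_mem haΓ (pow_mem hbΓ 3)
  exact fun γ hγ => hle hγ
end

section
/- Let φ ∈ GL₂(ℝ) be such that (0,φ)·Γ·(0,φ)⁻¹ ⊆ Γ, where Γ ≤ Aff(ℝ²) is the Klein bottle group. Then φ is a diagonal matrix diag(k, l) with k ∈ ℤ and l an odd integer (l = 2m+1 for some m ∈ ℤ). -/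
theorem diagB_mul_self : diagB * diagB = 1 := Units.ext diagB.val_inv

theorem diagB_inv : diagB⁻¹ = diagB := rfl

theorem diagB_ne_one : diagB ≠ 1 := by
  intro h
  have hval : diagB.val = 1 := Units.ext_iff.mp h
  have h00 := congrFun (congrFun hval 0) 0
  norm_num [diagB] at h00

/-- Every element of the Klein bottle group has translation part `(p, q/2)` with `p, q ∈ ℤ`,
and linear part `I` or `diag(−1,1)` according to the parity of `q`. -/
theorem exists_int_of_mem_GammaK {g : AffR 2} (hg : g ∈ GammaK) :
    ∃ p q : ℤ, g.v = ![(p : ℝ), (q : ℝ) / 2] ∧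
      (Even q ∧ g.m = 1 ∨ Odd q ∧ g.m = diagB) := by
  induction hg using Subgroup.closure_induction with
  | mem x hx =>
    rcases hx with rfl | rfl
    · exact ⟨1, 0, by simp [aK], Or.inl ⟨Even.zero, rfl⟩⟩
    · exact ⟨0, 1, by simp [bK], Or.inr ⟨odd_one, rfl⟩⟩
  | one => exact ⟨0, 0, by ext i; fin_cases i <;> simp, Or.inl ⟨Even.zero, rfl⟩⟩
  | mul x y _ _ hx hy =>
    obtain ⟨p, q, hv, hm⟩ := hx
    obtain ⟨p', q', hv', hm'⟩ := hy
    rcases hm with ⟨hq, hm⟩ | ⟨hq, hm⟩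
    · refine ⟨p + p', q + q', ?_, ?_⟩
      · ext i
        fin_cases i <;> simp [hv, hv', hm, add_div]
      · rcases hm' with ⟨hq', hm'⟩ | ⟨hq', hm'⟩
        · exact Or.inl ⟨hq.add hq', by simp [hm, hm']⟩
        · exact Or.inr ⟨hq.add_odd hq', by simp [hm, hm']⟩
    · refine ⟨p - p', q + q', ?_, ?_⟩
      · ext i
        fin_cases i <;> simp [hv, hv', hm, diagB, add_div, sub_eq_add_neg]
      · rcases hm' with ⟨hq', hm'⟩ | ⟨hq', hm'⟩
        · exact Or.inr ⟨hq.add_even hq', by simp [hm, hm']⟩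
        · exact Or.inl ⟨hq.add_odd hq', by simp [hm, hm', diagB_mul_self]⟩
  | inv x _ hx =>
    obtain ⟨p, q, hv, ⟨hq, hm⟩ | ⟨hq, hm⟩⟩ := hx
    · refine ⟨-p, -q, ?_, Or.inl ⟨hq.neg, by simp [hm]⟩⟩
      ext i
      fin_cases i <;> simp [hv, hm, neg_div]
    · refine ⟨p, -q, ?_, Or.inr ⟨hq.neg, by simp [hm, diagB_inv]⟩⟩
      ext i
      rw [AffR.inv_v, hm, diagB_inv]
      fin_cases i <;> simp [hv, diagB, neg_div]

/-- Let `φ ∈ GL₂(ℝ)` be such that `(0,φ)·Γ·(0,φ)⁻¹ ⊆ Γ`, where `Γ` is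
the Klein bottle group. Then `φ = diag(k, l)` with `k ∈ ℤ` and `l = 2m+1` odd. -/
theorem linear_normalizer_of_klein_group (phi : GL (Fin 2) ℝ)
    (hconj : ∀ γ ∈ GammaK,
      (⟨0, phi⟩ : AffR 2) * γ * (⟨0, phi⟩ : AffR 2)⁻¹ ∈ GammaK) :
    ∃ k m : ℤ, phi.val = !![(k : ℝ), 0; 0, ((2 * m + 1 : ℤ) : ℝ)] := by
  obtain ⟨k, _, hav, -⟩ :=
    exists_int_of_mem_GammaK (hconj aK (Subgroup.subset_closure (by simp)))
  obtain ⟨p, q, hbv, hbm⟩ :=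
    exists_int_of_mem_GammaK (hconj bK (Subgroup.subset_closure (by simp)))
  have h00 : phi.val 0 0 = k := by
    simpa [aK, Matrix.mulVec, dotProduct] using congrFun hav 0
  have h11 : phi.val 1 1 = q := by
    have h := congrFun hbv 1
    simp [bK] at h
    linarith
  rcases hbm with ⟨-, hm⟩ | ⟨⟨m, rfl⟩, hm⟩
  · exact absurd (conj_eq_one_iff.mp hm) diagB_ne_one
  · have hcomm : phi.val * diagB.val = diagB.val * phi.val :=
      congrArg Units.val (mul_inv_eq_iff_eq_mul.mp hm)
    have h01 : phi.val 0 1 = 0 := by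
      have h := congrFun (congrFun hcomm 0) 1
      simp [diagB, Matrix.mul_apply] at h
      linarith
    have h10 : phi.val 1 0 = 0 := by
      have h := congrFun (congrFun hcomm 1) 0
      simp [diagB, Matrix.mul_apply] at h
      linarith
    refine ⟨k, m, ?_⟩
    rw [Matrix.eta_fin_two phi.val, h00, h01, h10, h11]
end

section
/- For all integers k and m, there is no group automorphism h of ℤ/2ℤ × ℤ such that h ∘ A = B ∘ h, where A : ℤ/2ℤ × ℤ → ℤ/2ℤ × ℤ is the endomorphism A(x, n) = (x + n mod 2, 3n) and B is the endomorphism B(x, n) = (k·x, (2m+1)·n). (This is the abelianization obstruction in the paper's proof that the expanding affine endomorphism of the Klein bottle induced by α is not topologically conjugate to any infra-nilmanifold endomorphism.) -/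
/-- the abelianization obstruction in the paper's proof that the
expanding affine endomorphism of the Klein bottle induced by `α` is not topologically
conjugate to any infra-nilmanifold endomorphism. For all integers `k` and `m`, there is
no group automorphism `h` of `ℤ/2ℤ × ℤ` with `h ∘ A = B ∘ h`, where
`A(x, n) = (x + n mod 2, 3n)` and `B(x, n) = (k·x, (2m+1)·n)`. -/
theorem no_conjugating_automorphism_of_abelianization (k m : ℤ) :
    ¬ ∃ h : (ZMod 2 × ℤ) ≃+ (ZMod 2 × ℤ),
        ∀ p : ZMod 2 × ℤ,
          h (p.1 + (p.2 : ZMod 2), 3 * p.2) =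
            ((k : ZMod 2) * (h p).1, (2 * m + 1) * (h p).2) := by
  rintro ⟨h, hA⟩
  have two_torsion : h (1, 0) + h (1, 0) = 0 := by
    rw [← map_add, show ((1, 0) : ZMod 2 × ℤ) + (1, 0) = 0 by decide, map_zero]
  have snd_zero : (h (1, 0)).2 = 0 := by
    have := congrArg Prod.snd two_torsion
    simp only [Prod.snd_add, Prod.snd_zero] at this
    lia
  have fst_ne_zero : (h (1, 0)).1 ≠ 0 := fun h0 => by
    have : h (1, 0) = 0 := Prod.ext h0 snd_zero
    rw [map_eq_zero_iff h h.injective] at this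
    exact absurd this (by decide)
  have torsion_eq := congrArg Prod.fst (hA (1, 0))
  have generator_eq := congrArg Prod.fst (hA (0, 1))
  have split : ((0 + ((1 : ℤ) : ZMod 2), 3 * 1) : ZMod 2 × ℤ) = (1, 0) + 3 • (0, 1) := by decide
  simp only [Int.cast_zero, add_zero, mul_zero] at torsion_eq
  simp only [split, map_add, map_nsmul, Prod.fst_add, Prod.smul_fst] at generator_eq
  clear hA two_torsion snd_zero split
  generalize (h (1, 0)).1 = a at *
  generalize (h (0, 1)).1 = b at *
  generalize (k : ZMod 2) = c at *
  revert a b c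
  decide
end

section
/- Let Γ ≤ Aff(ℝ²) be the Klein bottle group and α = ((1/2,0), 3·I₂). For every group automorphism h of Γ, every φ ∈ GL₂(ℝ) with (0,φ)·Γ·(0,φ)⁻¹ ⊆ Γ, and all δ₁, δ₂ ∈ Γ, it is NOT the case that h(δ₁ (α γ α⁻¹) δ₁⁻¹) = δ₂ ((0,φ) h(γ) (0,φ)⁻¹) δ₂⁻¹ for all γ ∈ Γ. (Hence the expanding affine endomorphism of the Klein bottle induced by α is, even up to inner automorphisms of the fundamental group, never conjugate to the endomorphism induced by a linear automorphism; this is the group-theoretic core of the paper's counterexample to Gromov's geometric corollary as proved via Franks and Shub.) -/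
theorem exists_int_eq_of_mem_GammaK {γ : AffR 2} (hγ : γ ∈ GammaK) :
    (∃ x : ℤ, γ.v 0 = x) ∧ (γ.m = 1 ∨ γ.m = diagB) := by
  have hB : diagB * diagB = 1 := by
    ext i j; fin_cases i <;> fin_cases j <;> simp [diagB, Matrix.mul_apply]
  have hBinv : diagB⁻¹ = diagB := inv_eq_of_mul_eq_one_right hB
  induction hγ using Subgroup.closure_induction with
  | mem x hx =>
    rcases hx with rfl | rfl
    · exact ⟨⟨1, by simp [aK]⟩, Or.inl rfl⟩
    · exact ⟨⟨0, by simp [bK]⟩, Or.inr rfl⟩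
  | one => exact ⟨⟨0, by simp⟩, Or.inl rfl⟩
  | mul x y _ _ ihx ihy =>
    obtain ⟨⟨p, hp⟩, hx⟩ := ihx
    obtain ⟨⟨q, hq⟩, hy⟩ := ihy
    constructor
    · rcases hx with hx | hx
      · exact ⟨p + q, by simp [hx, hp, hq]⟩
      · exact ⟨p - q, by simp [hx, hp, hq, diagB, dotProduct]; ring⟩
    · rcases hx with hx | hx <;> rcases hy with hy | hy <;> simp [hx, hy, hB]
  | inv x _ ih =>
    obtain ⟨⟨p, hp⟩, hx⟩ := ih
    constructor
    · rcases hx with hx | hx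
      · exact ⟨-p, by simp [hx, hp]⟩
      · exact ⟨p, by simp [hx, hp, hBinv]; simp [diagB]⟩
    · rcases hx with hx | hx <;> simp [hx, hBinv]

/-- The homomorphism from the Klein bottle group to an abelian group that records the parity of
the horizontal translation part and the determinant of the linear part. -/
noncomputable def kleinParity : GammaK →* Multiplicative (ZMod 2) × ℝˣ :=
  MonoidHom.prod
    { toFun := fun γ => Multiplicative.ofAdd ((⌊(γ : AffR 2).v 0⌋ : ℤ) : ZMod 2)
      map_one' := by simp
      map_mul' := by
        rintro ⟨x, hx⟩ ⟨y, hy⟩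
        obtain ⟨⟨p, hp⟩, hx⟩ := exists_int_eq_of_mem_GammaK hx
        obtain ⟨⟨q, hq⟩, -⟩ := exists_int_eq_of_mem_GammaK hy
        rw [← ofAdd_add]
        congr 1
        rcases hx with hx | hx
        · have : (x * y).v 0 = ((p + q : ℤ) : ℝ) := by simp [hx, hp, hq]
          simp only [Subgroup.coe_mul, this, hp, hq, Int.floor_intCast]
          push_cast; rfl
        · have : (x * y).v 0 = ((p - q : ℤ) : ℝ) := by
            simp [hx, hp, hq, diagB, dotProduct]; ring
          simp only [Subgroup.coe_mul, this, hp, hq, Int.floor_intCast]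
          push_cast; exact CharTwo.sub_eq_add _ _ }
    { toFun := fun γ => Matrix.GeneralLinearGroup.det (γ : AffR 2).m
      map_one' := by simp
      map_mul' := by simp }

theorem kleinParity_apply (γ : GammaK) :
    kleinParity γ = (Multiplicative.ofAdd ((⌊(γ : AffR 2).v 0⌋ : ℤ) : ZMod 2),
      Matrix.GeneralLinearGroup.det (γ : AffR 2).m) := rfl

theorem det_diagB : Matrix.GeneralLinearGroup.det diagB = -1 := by
  ext; simp [diagB]

theorem kleinParity_mul_self (γ : GammaK) : kleinParity γ * kleinParity γ = 1 := by
  rw [kleinParity_apply]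
  ext1
  · exact CharTwo.add_self_eq_zero (R := ZMod 2) _
  · rcases (exists_int_eq_of_mem_GammaK γ.2).2 with h | h <;> simp [h, det_diagB]

theorem kleinParity_pow_three (γ : GammaK) : kleinParity γ ^ 3 = kleinParity γ := by
  rw [pow_succ, sq, kleinParity_mul_self, one_mul]

/-- A linear map normalizing the Klein bottle group into itself acts on the horizontal parity
as multiplication by a constant. -/
theorem exists_kleinParity_linear_conj (phi : GL (Fin 2) ℝ)
    (hconj : ∀ γ ∈ GammaK, (⟨0, phi⟩ : AffR 2) * γ * (⟨0, phi⟩ : AffR 2)⁻¹ ∈ GammaK) :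
    ∃ p : ZMod 2, ∀ γ : GammaK, kleinParity ⟨_, hconj γ γ.2⟩ =
      (Multiplicative.ofAdd (p * (kleinParity γ).1.toAdd), (kleinParity γ).2) := by
  have ha : aK ∈ GammaK := Subgroup.subset_closure (by simp)
  have hb : bK ∈ GammaK := Subgroup.subset_closure (by simp)
  have hcomm : phi * diagB = diagB * phi := by
    rcases (exists_int_eq_of_mem_GammaK (hconj _ hb)).2 with h | h
    · have h' := congrArg Matrix.GeneralLinearGroup.det h
      have h'' := congrArg Units.val h'
      simp [bK, det_diagB] at h''
      norm_num at h''
    · exact mul_inv_eq_iff_eq_mul.mp h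
  have h01 : phi.val 0 1 = 0 := by
    have h := congrArg (fun M : GL (Fin 2) ℝ => M.val 0 1) hcomm
    simp [diagB, Matrix.mul_apply] at h
    linarith
  obtain ⟨p, hp⟩ := (exists_int_eq_of_mem_GammaK (hconj _ ha)).1
  have hp : phi.val 0 0 = p := by
    simpa [aK, Matrix.mulVec, dotProduct] using hp
  refine ⟨p, fun γ => ?_⟩
  obtain ⟨x, hx⟩ := (exists_int_eq_of_mem_GammaK γ.2).1
  have hv : ((⟨0, phi⟩ : AffR 2) * γ * (⟨0, phi⟩ : AffR 2)⁻¹).v 0 = ((p * x : ℤ) : ℝ) := by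
    simp [Matrix.mulVec_eq_sum, h01, hp, hx, mul_comm]
  simp only [kleinParity_apply, hv, hx, Int.floor_intCast]
  ext1
  · simp
  · simp

/-- group-theoretic core of the paper's counterexample to Gromov's
geometric corollary as proved via Franks and Shub. For every automorphism `h` of the
Klein bottle group `Γ`, every `φ ∈ GL₂(ℝ)` with `(0,φ)·Γ·(0,φ)⁻¹ ⊆ Γ`, and all
`δ₁, δ₂ ∈ Γ`, it is NOT the case that
`h(δ₁ (α γ α⁻¹) δ₁⁻¹) = δ₂ ((0,φ) h(γ) (0,φ)⁻¹) δ₂⁻¹` for all `γ ∈ Γ`.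
(Here `γ'` ranges over the elements of `Γ` whose image in `Aff(ℝ²)` is `α γ α⁻¹`;
recall `α Γ α⁻¹ ⊆ Γ`.) -/
theorem klein_affine_endo_not_conjugate_to_linear (h : ↥GammaK ≃* ↥GammaK)
    (phi : GL (Fin 2) ℝ)
    (hconj : ∀ γ ∈ GammaK,
      (⟨0, phi⟩ : AffR 2) * γ * (⟨0, phi⟩ : AffR 2)⁻¹ ∈ GammaK)
    (δ₁ δ₂ : ↥GammaK) :
    ¬ ∀ (γ γ' : ↥GammaK), (γ' : AffR 2) = alphaK * (γ : AffR 2) * alphaK⁻¹ →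
        ((h (δ₁ * γ' * δ₁⁻¹) : ↥GammaK) : AffR 2) =
          (δ₂ : AffR 2) *
            ((⟨0, phi⟩ : AffR 2) * ((h γ : ↥GammaK) : AffR 2) * (⟨0, phi⟩ : AffR 2)⁻¹) *
              (δ₂ : AffR 2)⁻¹ := by
  intro H
  have haΓ : aK ∈ GammaK := Subgroup.subset_closure (by simp)
  have hbΓ : bK ∈ GammaK := Subgroup.subset_closure (by simp)
  set a : GammaK := ⟨aK, haΓ⟩
  set b : GammaK := ⟨bK, hbΓ⟩
  obtain ⟨p, hp⟩ := exists_kleinParity_linear_conj phi hconj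
  have key : ∀ γ γ' : GammaK, (γ' : AffR 2) = alphaK * (γ : AffR 2) * alphaK⁻¹ →
      kleinParity (h γ') = (Multiplicative.ofAdd (p * (kleinParity (h γ)).1.toAdd),
        (kleinParity (h γ)).2) := by
    intro γ γ' hγ
    have e : h (δ₁ * γ' * δ₁⁻¹) = δ₂ * ⟨_, hconj _ (h γ).2⟩ * δ₂⁻¹ := Subtype.ext (H γ γ' hγ)
    have e' := congrArg kleinParity e
    simp only [map_mul, map_inv, mul_inv_cancel_comm] at e'
    rw [e', hp]
  have ea := key a (a ^ 3) (by
    change aK ^ 3 = alphaK * aK * alphaK⁻¹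
    rw [eq_mul_inv_iff_mul_eq, pow_succ, sq]
    ext i j
    · fin_cases i <;> simp [aK, alphaK, threeI] <;> norm_num
    · simp [aK, alphaK])
  have eb := key b (a * b ^ 3) (by
    change aK * bK ^ 3 = alphaK * bK * alphaK⁻¹
    rw [eq_mul_inv_iff_mul_eq, pow_succ, sq]
    ext i j
    · fin_cases i <;>
        simp [aK, bK, alphaK, threeI, diagB, Matrix.vecHead, Matrix.vecTail] <;> norm_num
    · fin_cases i <;> fin_cases j <;>
        simp [aK, bK, alphaK, threeI, diagB, Matrix.mul_apply])
  simp only [map_mul, map_pow, kleinParity_pow_three] at ea eb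
  have hone : kleinParity (h a) = 1 := by
    have e1 : (kleinParity (h a)).1.toAdd = p * (kleinParity (h a)).1.toAdd :=
      congrArg (fun t => t.1.toAdd) ea
    have e2 : (kleinParity (h a)).1.toAdd + (kleinParity (h b)).1.toAdd =
      p * (kleinParity (h b)).1.toAdd := congrArg (fun t => t.1.toAdd) eb
    have e3 : (kleinParity (h a)).2 * (kleinParity (h b)).2 = (kleinParity (h b)).2 :=
      congrArg Prod.snd eb
    have aux : ∀ p x z : ZMod 2, x = p * x → x + z = p * z → x = 0 := by decide
    exact Prod.ext (aux _ _ _ e1 e2) (mul_eq_right.mp e3)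
  have hgen : ∀ γ : GammaK, kleinParity (h γ) = 1 ∨ kleinParity (h γ) = kleinParity (h b) := by
    have hs := kleinParity_mul_self (h b)
    rintro ⟨γ, hγ⟩
    induction hγ using Subgroup.closure_induction with
    | mem x hx =>
      rcases hx with rfl | rfl
      · exact Or.inl hone
      · exact Or.inr rfl
    | one => exact Or.inl ((congrArg kleinParity (map_one h)).trans (map_one _))
    | mul x y hx hy ihx ihy =>
      have e : kleinParity (h ⟨x * y, mul_mem hx hy⟩) =
          kleinParity (h ⟨x, hx⟩) * kleinParity (h ⟨y, hy⟩) := by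
        rw [← map_mul, ← map_mul]; rfl
      rw [e]
      rcases ihx with ihx | ihx <;> rcases ihy with ihy | ihy <;> simp [ihx, ihy, hs]
    | inv x hx ih =>
      have e : kleinParity (h ⟨x⁻¹, inv_mem hx⟩) = (kleinParity (h ⟨x, hx⟩))⁻¹ := by
        rw [← map_inv, ← map_inv]; rfl
      rw [e]
      rcases ih with ih | ih
      · simp [ih]
      · exact Or.inr (by rw [ih]; exact inv_eq_of_mul_eq_one_right hs)
  have hsurj : ∀ γ : GammaK, kleinParity γ = 1 ∨ kleinParity γ = kleinParity (h b) := fun γ => by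
    simpa using hgen (h.symm γ)
  have ha : kleinParity a = (Multiplicative.ofAdd 1, 1) := by
    simp [kleinParity_apply, a, aK]
  have hb : kleinParity b = (Multiplicative.ofAdd 0, -1) := by
    simp [kleinParity_apply, b, bK, det_diagB]
  have ha1 : kleinParity a ≠ 1 := fun e => by
    rw [ha] at e
    exact absurd (congrArg (fun t => t.1.toAdd) e) (by decide : ¬ (1 : ZMod 2) = 0)
  have hneg : (-1 : ℝˣ) ≠ 1 := fun e => by
    have := congrArg Units.val e
    norm_num at this
  have hb1 : kleinParity b ≠ 1 := fun e => hneg (by rw [hb] at e; exact congrArg Prod.snd e)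
  have hab := ((hsurj a).resolve_left ha1).trans ((hsurj b).resolve_left hb1).symm
  rw [ha, hb] at hab
  exact hneg (congrArg Prod.snd hab).symm
end

section
/- Let Γ ≤ Aff(ℝ²) be the Klein bottle group and let g be the group automorphism of Γ determined by g(a) = a and g(b) = a·b. Then there is no group automorphism Φ of Γ and no φ ∈ GL₂(ℝ) with (0,φ)·Γ·(0,φ)⁻¹ ⊆ Γ such that Φ(g(γ)) = (0,φ)·Φ(γ)·(0,φ)⁻¹ for all γ ∈ Γ. (This is the paper's counterexample to Franks' 'Existence of a Model' Proposition 3.5: the homeomorphism of the Klein bottle inducing g is not π₁-conjugate to any infra-nilmanifold endomorphism.) -/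
/-- `a` as an element of the Klein bottle group. -/
noncomputable def aGamma : ↥GammaK := ⟨aK, Subgroup.subset_closure (Set.mem_insert _ _)⟩

/-- `b` as an element of the Klein bottle group. -/
noncomputable def bGamma : ↥GammaK :=
  ⟨bK, Subgroup.subset_closure (Set.mem_insert_of_mem _ rfl)⟩

theorem val_diagB : diagB.val = !![-1, 0; 0, 1] := rfl

/-- The holonomy of the Klein bottle group is `{1, diag(−1,1)}`. -/
theorem linearPart_of_mem_GammaK {x : AffR 2} (hx : x ∈ GammaK) : x.m = 1 ∨ x.m = diagB := by
  induction hx using Subgroup.closure_induction with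
  | mem x hx =>
    rcases hx with rfl | rfl
    · exact Or.inl rfl
    · exact Or.inr rfl
  | one => exact Or.inl rfl
  | mul x y _ _ hx hy =>
    rcases hx with hx | hx <;> rcases hy with hy | hy <;> simp [hx, hy, diagB_mul_self]
  | inv x _ hx =>
    rcases hx with hx | hx <;> simp [hx, diagB_inv]

theorem aK_conj : bK * aK = aK⁻¹ * bK := by
  refine AffR.ext ?_ ?_
  · ext i
    fin_cases i <;> simp [aK, bK, val_diagB, Matrix.vecHead]
  · simp [aK, bK]

theorem aK_sq_ne_one : aK * aK ≠ 1 := fun h => by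
  have h0 := congrFun (congrArg AffR.v h) 0
  norm_num [aK] at h0

theorem bK_sq_ne_one : bK * bK ≠ 1 := fun h => by
  have h1 := congrFun (congrArg AffR.v h) 1
  norm_num [bK, val_diagB, Matrix.vecHead, Matrix.vecTail] at h1

/-- Elements `A`, `B` with the holonomy of the Klein bottle group that satisfy its relation
and have nontrivial squares are, respectively, a horizontal translation and a glide reflection
along the vertical axis. -/
theorem form_of_klein_relation {A B : AffR 2} (hA : A.m = 1 ∨ A.m = diagB)
    (hB : B.m = 1 ∨ B.m = diagB) (h : B * A = A⁻¹ * B) (hA2 : A * A ≠ 1) (hB2 : B * B ≠ 1) :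
    A.m = 1 ∧ B.m = diagB ∧ A.v 1 = 0 ∧ A.v 0 ≠ 0 ∧ B.v 1 ≠ 0 := by
  have hv := congrArg AffR.v (show A * (B * A) = B by rw [h, mul_inv_cancel_left])
  have hv0 := congrFun hv 0
  have hv1 := congrFun hv 1
  have hA1 : A.v 1 = 0 := by
    rcases hA with hA | hA <;> rcases hB with hB | hB <;>
      simp [hA, hB, val_diagB, Matrix.vecHead, Matrix.vecTail] at hv1 <;> linarith
  have hAm : A.m = 1 := by
    refine hA.resolve_right fun hA => hA2 (AffR.ext ?_ ?_)
    · ext i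
      fin_cases i <;> simp [hA, val_diagB, Matrix.vecHead, Matrix.vecTail, hA1]
    · simp [hA, diagB_mul_self]
  have hA0 : A.v 0 ≠ 0 := by
    refine fun hA0 => hA2 (AffR.ext ?_ ?_)
    · ext i
      fin_cases i <;> simp [hAm, hA1, hA0]
    · simp [hAm]
  have hBm : B.m = diagB := by
    refine hB.resolve_left fun hB => hA0 ?_
    simp [hAm, hB] at hv0
    linarith
  refine ⟨hAm, hBm, hA1, hA0, fun hB1 => hB2 (AffR.ext ?_ ?_)⟩
  · ext i
    fin_cases i <;> simp [hBm, val_diagB, Matrix.vecHead, Matrix.vecTail, hB1]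
  · simp [hBm, diagB_mul_self]

/-- Conjugation by a linear map acts on translation parts by that map. -/
theorem AffR.linear_conj_v {n : ℕ} (phi : GL (Fin n) ℝ) (x : AffR n) :
    ((⟨0, phi⟩ : AffR n) * x * (⟨0, phi⟩ : AffR n)⁻¹).v = phi.val.mulVec x.v := by
  simp

/-- the paper's counterexample to Franks' "Existence of a Model"
Proposition 3.5. Let `g` be the automorphism of the Klein bottle group `Γ` determined by
`g(a) = a` and `g(b) = a·b`. Then there is no automorphism `Φ` of `Γ` and no `φ ∈ GL₂(ℝ)`
with `(0,φ)·Γ·(0,φ)⁻¹ ⊆ Γ` such that `Φ(g(γ)) = (0,φ)·Φ(γ)·(0,φ)⁻¹` for all `γ ∈ Γ`. -/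
theorem no_model_for_klein_homeomorphism (g : ↥GammaK ≃* ↥GammaK)
    (hga : g aGamma = aGamma) (hgb : g bGamma = aGamma * bGamma) :
    ¬ ∃ (Φ : ↥GammaK ≃* ↥GammaK) (phi : GL (Fin 2) ℝ),
        (∀ γ ∈ GammaK,
          (⟨0, phi⟩ : AffR 2) * γ * (⟨0, phi⟩ : AffR 2)⁻¹ ∈ GammaK) ∧
        ∀ γ : ↥GammaK,
          ((Φ (g γ) : ↥GammaK) : AffR 2) =
            (⟨0, phi⟩ : AffR 2) * ((Φ γ : ↥GammaK) : AffR 2) * (⟨0, phi⟩ : AffR 2)⁻¹ := by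
  rintro ⟨Φ, phi, -, hconj⟩
  have hval : ∀ x y : ↥GammaK, ((Φ x * Φ y : ↥GammaK) : AffR 2) = Φ x * Φ y := fun _ _ => rfl
  have hrel : bGamma * aGamma = aGamma⁻¹ * bGamma := Subtype.ext aK_conj
  have hgbb : g (bGamma * bGamma) = bGamma * bGamma := by
    rw [map_mul, hgb, mul_assoc, ← mul_assoc bGamma, hrel]
    group
  have hsq : ∀ x : ↥GammaK, (x : AffR 2) * x ≠ 1 → (Φ x : AffR 2) * Φ x ≠ 1 := by
    intro x hx h
    refine hx (congrArg Subtype.val (Φ.injective (a₁ := x * x) (a₂ := 1) ?_))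
    rw [map_mul, map_one]
    exact Subtype.ext h
  have hΦrel : (Φ bGamma : AffR 2) * Φ aGamma = (Φ aGamma : AffR 2)⁻¹ * Φ bGamma := by
    simpa using congrArg (fun x => (Φ x : AffR 2)) hrel
  have hv : ∀ x : ↥GammaK, (Φ (g x) : AffR 2).v = phi.val.mulVec (Φ x : AffR 2).v := fun x => by
    rw [hconj, AffR.linear_conj_v]
  have ha := hv aGamma
  have hb := hv bGamma
  have hbb := hv (bGamma * bGamma)
  rw [hga] at ha
  rw [hgb, map_mul, Subgroup.coe_mul] at hb
  rw [hgbb, map_mul, Subgroup.coe_mul] at hbb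
  obtain ⟨hAm, hBm, hA1, hA0, hB1⟩ := form_of_klein_relation
    (linearPart_of_mem_GammaK (Φ aGamma).2) (linearPart_of_mem_GammaK (Φ bGamma).2) hΦrel
    (hsq aGamma aK_sq_ne_one) (hsq bGamma bK_sq_ne_one)
  generalize (Φ aGamma : AffR 2) = A at *
  generalize (Φ bGamma : AffR 2) = B at *
  have ha0 := congrFun ha 0
  have hbb0 := congrFun hbb 0
  have hb0 := congrFun hb 0
  simp only [AffR.mul_v, hAm, hBm, val_diagB, Matrix.mulVec, dotProduct, Fin.sum_univ_two,
    Pi.add_apply, Units.val_one, Matrix.one_apply, hA1] at ha0 hbb0 hb0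
  simp at ha0 hbb0 hb0
  have h00 : phi.val 0 0 = 1 := by grind
  have h01 : phi.val 0 1 = 0 := by grind
  grind
end

section
/- For the 4-dimensional Bieberbach group Γ ≤ Aff(ℝ⁴) and α = ((1/2,1/2,0,0), M), one has α a α⁻¹ = a¹³ b⁸, α b α⁻¹ = a⁸ b⁵, α c α⁻¹ = c¹³ d⁸, α d α⁻¹ = c⁸ d⁵, and α f α⁻¹ = a b c¹⁰ d⁶ f; consequently α Γ α⁻¹ = Γ. -/
/-- `L = diag(−1,−1,1,1)` as an element of `GL₄(ℝ)`. -/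
noncomputable def LGL : GL (Fin 4) ℝ :=
  ⟨!![-1,0,0,0; 0,-1,0,0; 0,0,1,0; 0,0,0,1], !![-1,0,0,0; 0,-1,0,0; 0,0,1,0; 0,0,0,1],
    by
      ext i j
      fin_cases i <;> fin_cases j <;>
        simp [Matrix.mul_apply, Fin.sum_univ_succ, Matrix.one_apply] <;> norm_num,
    by
      ext i j
      fin_cases i <;> fin_cases j <;>
        simp [Matrix.mul_apply, Fin.sum_univ_succ, Matrix.one_apply] <;> norm_num⟩

/-- The block-diagonal matrix with two copies of `[[13,8],[8,5]]` on the diagonal,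
as an element of `GL₄(ℝ)`. -/
noncomputable def MGL : GL (Fin 4) ℝ :=
  ⟨!![13,8,0,0; 8,5,0,0; 0,0,13,8; 0,0,8,5], !![5,-8,0,0; -8,13,0,0; 0,0,5,-8; 0,0,-8,13],
    by
      ext i j
      fin_cases i <;> fin_cases j <;>
        simp [Matrix.mul_apply, Fin.sum_univ_succ, Matrix.one_apply] <;> norm_num,
    by
      ext i j
      fin_cases i <;> fin_cases j <;>
        simp [Matrix.mul_apply, Fin.sum_univ_succ, Matrix.one_apply] <;> norm_num⟩

/-- `a`, the translation by `e₁`. -/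
noncomputable def a4 : AffR 4 := AffR.tr ![1, 0, 0, 0]

/-- `b`, the translation by `e₂`. -/
noncomputable def b4 : AffR 4 := AffR.tr ![0, 1, 0, 0]

/-- `c`, the translation by `e₃`. -/
noncomputable def c4 : AffR 4 := AffR.tr ![0, 0, 1, 0]

/-- `d`, the translation by `e₄`. -/
noncomputable def d4 : AffR 4 := AffR.tr ![0, 0, 0, 1]

/-- `f = ((0,0,1/2,1/2), L) ∈ Aff(ℝ⁴)`. -/
noncomputable def f4 : AffR 4 := ⟨![0, 0, 1/2, 1/2], LGL⟩

/-- The 4-dimensional Bieberbach group `Γ ≤ Aff(ℝ⁴)` of the paper's Section 5 example,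
generated by `a`, `b`, `c`, `d` and `f`. -/
noncomputable def Gamma4 : Subgroup (AffR 4) := Subgroup.closure {a4, b4, c4, d4, f4}

/-- `α = ((1/2,1/2,0,0), M) ∈ Aff(ℝ⁴)`. -/
noncomputable def alpha4 : AffR 4 := ⟨![1/2, 1/2, 0, 0], MGL⟩

namespace AffR

variable {n : ℕ}

theorem tr_mul_tr (v w : Fin n → ℝ) : tr v * tr w = tr (v + w) := by
  ext <;> simp [tr]

theorem tr_pow (v : Fin n → ℝ) (k : ℕ) : tr v ^ k = tr ((k : ℝ) • v) := by
  induction k with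
  | zero => ext <;> simp [tr]
  | succ k ih => rw [pow_succ, ih, tr_mul_tr]; push_cast; rw [add_smul, one_smul]

theorem conj_tr (g : AffR n) (w : Fin n → ℝ) :
    g * tr w * g⁻¹ = tr (g.m.val.mulVec w) := by
  rw [mul_inv_eq_iff_eq_mul]
  ext <;> simp [tr, add_comm]

end AffR

theorem MGL_val : MGL.val = !![13,8,0,0; 8,5,0,0; 0,0,13,8; 0,0,8,5] := rfl

theorem LGL_val : LGL.val = !![-1,0,0,0; 0,-1,0,0; 0,0,1,0; 0,0,0,1] := rfl

theorem MGL_mul_LGL : MGL * LGL = LGL * MGL := by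
  ext i j
  rw [Units.val_mul, Units.val_mul, MGL_val, LGL_val]
  fin_cases i <;> fin_cases j <;> simp [Matrix.mul_apply, Fin.sum_univ_succ]

theorem alpha4_conj_a4 : alpha4 * a4 * alpha4⁻¹ = a4 ^ 13 * b4 ^ 8 := by
  simp only [a4, b4, AffR.conj_tr, AffR.tr_pow, AffR.tr_mul_tr, alpha4, MGL_val]
  congr 1
  ext i
  fin_cases i <;> simp [Matrix.mulVec, dotProduct, Fin.sum_univ_succ]

theorem alpha4_conj_b4 : alpha4 * b4 * alpha4⁻¹ = a4 ^ 8 * b4 ^ 5 := by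
  simp only [a4, b4, AffR.conj_tr, AffR.tr_pow, AffR.tr_mul_tr, alpha4, MGL_val]
  congr 1
  ext i
  fin_cases i <;> simp [Matrix.mulVec, dotProduct, Fin.sum_univ_succ]

theorem alpha4_conj_c4 : alpha4 * c4 * alpha4⁻¹ = c4 ^ 13 * d4 ^ 8 := by
  simp only [c4, d4, AffR.conj_tr, AffR.tr_pow, AffR.tr_mul_tr, alpha4, MGL_val]
  congr 1
  ext i
  fin_cases i <;> simp [Matrix.mulVec, dotProduct, Fin.sum_univ_succ]

theorem alpha4_conj_d4 : alpha4 * d4 * alpha4⁻¹ = c4 ^ 8 * d4 ^ 5 := by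
  simp only [c4, d4, AffR.conj_tr, AffR.tr_pow, AffR.tr_mul_tr, alpha4, MGL_val]
  congr 1
  ext i
  fin_cases i <;> simp [Matrix.mulVec, dotProduct, Fin.sum_univ_succ]

theorem alpha4_conj_f4 :
    alpha4 * f4 * alpha4⁻¹ = a4 * b4 * c4 ^ 10 * d4 ^ 6 * f4 := by
  rw [mul_inv_eq_iff_eq_mul]
  simp only [a4, b4, c4, d4, AffR.tr_pow, AffR.tr_mul_tr]
  apply AffR.ext
  · simp only [AffR.mul_v, AffR.mul_m, AffR.tr, one_mul, Units.val_one, Matrix.one_mulVec,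
      alpha4, f4, MGL_val, LGL_val]
    ext i
    fin_cases i <;> simp <;> norm_num
  · simp [AffR.tr, alpha4, f4, MGL_mul_LGL]

/-- If `y` and `z` commute, `y` is recovered from `y ^ 13 * z ^ 8` and `y ^ 8 * z ^ 5`. -/
theorem Commute.pow_mul_pow_inv_eq_fst {G : Type*} [Group G] {y z : G} (h : Commute y z) :
    (y ^ 13 * z ^ 8) ^ 5 * ((y ^ 8 * z ^ 5) ^ 8)⁻¹ = y := by
  rw [(h.pow_pow 13 8).mul_pow, (h.pow_pow 8 5).mul_pow, mul_inv_eq_iff_eq_mul]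
  simp only [← pow_mul, ← mul_assoc, ← pow_succ']

/-- If `y` and `z` commute, `z` is recovered from `y ^ 13 * z ^ 8` and `y ^ 8 * z ^ 5`. -/
theorem Commute.pow_mul_pow_inv_eq_snd {G : Type*} [Group G] {y z : G} (h : Commute y z) :
    (y ^ 8 * z ^ 5) ^ 13 * ((y ^ 13 * z ^ 8) ^ 8)⁻¹ = z := by
  rw [(h.pow_pow 13 8).mul_pow, (h.pow_pow 8 5).mul_pow, mul_inv_eq_iff_eq_mul]
  simp only [← pow_mul, ← mul_assoc, (h.symm.pow_right _).eq]
  simp only [mul_assoc, ← pow_succ']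

theorem map_conj_alpha4_Gamma4 :
    Subgroup.map (MulAut.conj alpha4).toMonoidHom Gamma4 = Gamma4 := by
  have ha : a4 ∈ Gamma4 := Subgroup.subset_closure (by simp)
  have hb : b4 ∈ Gamma4 := Subgroup.subset_closure (by simp)
  have hc : c4 ∈ Gamma4 := Subgroup.subset_closure (by simp)
  have hd : d4 ∈ Gamma4 := Subgroup.subset_closure (by simp)
  have hf : f4 ∈ Gamma4 := Subgroup.subset_closure (by simp)
  set H := Subgroup.map (MulAut.conj alpha4).toMonoidHom Gamma4 with hH
  have conj_mem : ∀ {x}, x ∈ Gamma4 → alpha4 * x * alpha4⁻¹ ∈ H := fun hx =>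
    Subgroup.mem_map_of_mem (MulAut.conj alpha4).toMonoidHom hx
  apply le_antisymm
  · rw [hH, Subgroup.map_le_iff_le_comap]
    refine (Subgroup.closure_le _).2 ?_
    rintro x (rfl | rfl | rfl | rfl | rfl) <;>
      simp only [Subgroup.coe_comap, Set.mem_preimage, MulEquiv.toMonoidHom_eq_coe,
        MonoidHom.coe_coe, MulAut.conj_apply, SetLike.mem_coe]
    · rw [alpha4_conj_a4]; exact mul_mem (pow_mem ha _) (pow_mem hb _)
    · rw [alpha4_conj_b4]; exact mul_mem (pow_mem ha _) (pow_mem hb _)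
    · rw [alpha4_conj_c4]; exact mul_mem (pow_mem hc _) (pow_mem hd _)
    · rw [alpha4_conj_d4]; exact mul_mem (pow_mem hc _) (pow_mem hd _)
    · rw [alpha4_conj_f4]
      exact mul_mem (mul_mem (mul_mem (mul_mem ha hb) (pow_mem hc _)) (pow_mem hd _)) hf
  · have hab : Commute a4 b4 := by simp [Commute, SemiconjBy, a4, b4, AffR.tr_mul_tr, add_comm]
    have hcd : Commute c4 d4 := by simp [Commute, SemiconjBy, c4, d4, AffR.tr_mul_tr, add_comm]
    have ha' := alpha4_conj_a4 ▸ conj_mem ha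
    have hb' := alpha4_conj_b4 ▸ conj_mem hb
    have hc' := alpha4_conj_c4 ▸ conj_mem hc
    have hd' := alpha4_conj_d4 ▸ conj_mem hd
    have hf' := alpha4_conj_f4 ▸ conj_mem hf
    have haH : a4 ∈ H :=
      hab.pow_mul_pow_inv_eq_fst ▸ mul_mem (pow_mem ha' 5) (inv_mem (pow_mem hb' 8))
    have hbH : b4 ∈ H :=
      hab.pow_mul_pow_inv_eq_snd ▸ mul_mem (pow_mem hb' 13) (inv_mem (pow_mem ha' 8))
    have hcH : c4 ∈ H :=
      hcd.pow_mul_pow_inv_eq_fst ▸ mul_mem (pow_mem hc' 5) (inv_mem (pow_mem hd' 8))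
    have hdH : d4 ∈ H :=
      hcd.pow_mul_pow_inv_eq_snd ▸ mul_mem (pow_mem hd' 13) (inv_mem (pow_mem hc' 8))
    have hfH : f4 ∈ H := (Subgroup.mul_mem_cancel_left H
      (mul_mem (mul_mem (mul_mem haH hbH) (pow_mem hcH 10)) (pow_mem hdH 6))).1 hf'
    refine (Subgroup.closure_le _).2 ?_
    rintro x (rfl | rfl | rfl | rfl | rfl) <;> assumption

/-- For the 4-dimensional Bieberbach group `Γ ≤ Aff(ℝ⁴)` and
`α = ((1/2,1/2,0,0), M)`, one has `α a α⁻¹ = a¹³ b⁸`, `α b α⁻¹ = a⁸ b⁵`,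
`α c α⁻¹ = c¹³ d⁸`, `α d α⁻¹ = c⁸ d⁵` and `α f α⁻¹ = a b c¹⁰ d⁶ f`;
consequently `α Γ α⁻¹ = Γ`. -/
theorem alpha_conj_bieberbach4 :
    alpha4 * a4 * alpha4⁻¹ = a4 ^ 13 * b4 ^ 8 ∧
    alpha4 * b4 * alpha4⁻¹ = a4 ^ 8 * b4 ^ 5 ∧
    alpha4 * c4 * alpha4⁻¹ = c4 ^ 13 * d4 ^ 8 ∧
    alpha4 * d4 * alpha4⁻¹ = c4 ^ 8 * d4 ^ 5 ∧
    alpha4 * f4 * alpha4⁻¹ = a4 * b4 * c4 ^ 10 * d4 ^ 6 * f4 ∧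
    Subgroup.map (MulAut.conj alpha4).toMonoidHom Gamma4 = Gamma4 := by
  exact ⟨alpha4_conj_a4, alpha4_conj_b4, alpha4_conj_c4, alpha4_conj_d4, alpha4_conj_f4,
    map_conj_alpha4_Gamma4⟩
end

section
/- Let Γ ≤ Aff(ℝ⁴) be the 4-dimensional Bieberbach group of the paper's Section 5 example, and let φ ∈ GL₄(ℝ) satisfy (0,φ)·Γ·(0,φ)⁻¹ = Γ. Then φ is a block-diagonal matrix of the form [[A,0],[0,B]] where A and B are 2×2 integer matrices with determinant ±1 (i.e. A, B ∈ GL₂(ℤ)); moreover (0,φ)·f·(0,φ)⁻¹ = cᵏ dˡ f for some integers k, l. -/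
/-- The elements of `Gamma4` are integral translations and `f4` preceded by such a translation. -/
theorem Gamma4_mem_form {x : AffR 4} (hx : x ∈ Gamma4) :
    ∃ p q r s : ℤ, (x.m = 1 ∧ x.v = ![(p : ℝ), q, r, s]) ∨
      (x.m = LGL ∧ x.v = ![(p : ℝ), q, r + 1 / 2, s + 1 / 2]) := by
  have hLL : LGL * LGL = 1 := Units.ext LGL.val_inv
  have hLinv : LGL⁻¹ = LGL := inv_eq_of_mul_eq_one_left hLL
  have hLv (p q r s : ℝ) : LGL.val.mulVec ![p, q, r, s] = ![-p, -q, r, s] := by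
    ext i
    fin_cases i <;> simp [LGL, Matrix.mulVec, dotProduct, Fin.sum_univ_succ]
  induction hx using Subgroup.closure_induction with
  | mem x hx =>
    rcases hx with rfl | rfl | rfl | rfl | rfl
    · exact ⟨1, 0, 0, 0, Or.inl ⟨rfl, by simp [a4, AffR.tr]⟩⟩
    · exact ⟨0, 1, 0, 0, Or.inl ⟨rfl, by simp [b4, AffR.tr]⟩⟩
    · exact ⟨0, 0, 1, 0, Or.inl ⟨rfl, by simp [c4, AffR.tr]⟩⟩
    · exact ⟨0, 0, 0, 1, Or.inl ⟨rfl, by simp [d4, AffR.tr]⟩⟩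
    · exact ⟨0, 0, 0, 0, Or.inr ⟨rfl, by simp [f4]⟩⟩
  | one => exact ⟨0, 0, 0, 0, Or.inl ⟨rfl, by ext i; fin_cases i <;> simp⟩⟩
  | mul x y _ _ hx hy =>
    obtain ⟨p, q, r, s, ⟨hm, hv⟩ | ⟨hm, hv⟩⟩ := hx <;>
    obtain ⟨p', q', r', s', ⟨hm', hv'⟩ | ⟨hm', hv'⟩⟩ := hy
    · refine ⟨p + p', q + q', r + r', s + s', Or.inl ⟨by simp [hm, hm'], ?_⟩⟩
      simp [hm, hv, hv']
    · refine ⟨p + p', q + q', r + r', s + s', Or.inr ⟨by simp [hm, hm'], ?_⟩⟩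
      simp [hm, hv, hv', add_assoc]
    · refine ⟨p - p', q - q', r + r', s + s', Or.inr ⟨by simp [hm, hm'], ?_⟩⟩
      ext i
      fin_cases i <;> simp [hm, hv, hv', hLv] <;> ring
    · refine ⟨p - p', q - q', r + r' + 1, s + s' + 1, Or.inl ⟨by simp [hm, hm', hLL], ?_⟩⟩
      ext i
      fin_cases i <;> simp [hm, hv, hv', hLv] <;> ring
  | inv x _ hx =>
    obtain ⟨p, q, r, s, ⟨hm, hv⟩ | ⟨hm, hv⟩⟩ := hx
    · exact ⟨-p, -q, -r, -s, Or.inl ⟨by simp [hm], by simp [hm, hv]⟩⟩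
    · refine ⟨p, q, -r - 1, -s - 1, Or.inr ⟨by simp [hm, hLinv], ?_⟩⟩
      ext i
      fin_cases i <;> simp [hm, hv, hLinv, hLv] <;> ring

theorem LGL_ne_one : LGL ≠ 1 := by
  intro h
  have h0 := congrArg (fun g : GL (Fin 4) ℝ => g.val 0 0) h
  norm_num [LGL] at h0

theorem AffR.conj_linear {n : ℕ} (psi : GL (Fin n) ℝ) (x : AffR n) :
    (⟨0, psi⟩ : AffR n) * x * (⟨0, psi⟩ : AffR n)⁻¹ =
      ⟨psi.val.mulVec x.v, psi * x.m * psi⁻¹⟩ := by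
  ext <;> simp

/-- A linear map conjugating `Gamma4` into itself has integral entries. -/
theorem exists_int_entries_of_conj_mem (psi : GL (Fin 4) ℝ)
    (h : ∀ x ∈ Gamma4, (⟨0, psi⟩ : AffR 4) * x * (⟨0, psi⟩ : AffR 4)⁻¹ ∈ Gamma4) :
    ∃ Z : Matrix (Fin 4) (Fin 4) ℤ, ∀ i j, psi.val i j = Z i j := by
  have key (w : Fin 4 → ℝ) (hw : AffR.tr w ∈ Gamma4) (i : Fin 4) :
      ∃ z : ℤ, psi.val.mulVec w i = z := by
    have hmem := h _ hw
    rw [AffR.conj_linear] at hmem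
    obtain ⟨p, q, r, s, ⟨-, hv⟩ | ⟨hm, -⟩⟩ := Gamma4_mem_form hmem
    · simp only [AffR.tr] at hv
      rw [hv]
      fin_cases i
      exacts [⟨p, rfl⟩, ⟨q, rfl⟩, ⟨r, rfl⟩, ⟨s, rfl⟩]
    · exact absurd (by simpa [AffR.tr] using hm.symm) LGL_ne_one
  have entry (i j : Fin 4) : ∃ z : ℤ, psi.val i j = z := by
    fin_cases j
    · simpa [Matrix.mulVec, dotProduct, Fin.sum_univ_succ] using
        key ![1, 0, 0, 0] (Subgroup.subset_closure (by simp [a4])) i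
    · simpa [Matrix.mulVec, dotProduct, Fin.sum_univ_succ] using
        key ![0, 1, 0, 0] (Subgroup.subset_closure (by simp [b4])) i
    · simpa [Matrix.mulVec, dotProduct, Fin.sum_univ_succ] using
        key ![0, 0, 1, 0] (Subgroup.subset_closure (by simp [c4])) i
    · simpa [Matrix.mulVec, dotProduct, Fin.sum_univ_succ] using
        key ![0, 0, 0, 1] (Subgroup.subset_closure (by simp [d4])) i
  choose Z hZ using entry
  exact ⟨Z, hZ⟩

theorem Matrix.det_eq_one_or_neg_one_of_mul_eq_one {n : Type*} [Fintype n] [DecidableEq n]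
    {A B : Matrix n n ℤ} (h : A * B = 1) : A.det = 1 ∨ A.det = -1 :=
  Int.isUnit_iff.mp (IsUnit.of_mul_eq_one B.det (by rw [← Matrix.det_mul, h, Matrix.det_one]))

theorem c4_zpow_mul_d4_zpow (k l : ℤ) :
    c4 ^ k * d4 ^ l = AffR.tr ![0, 0, (k : ℝ), l] := by
  have hpow (w : Fin 4 → ℝ) (k : ℤ) : AffR.tr w ^ k = AffR.tr ((k : ℝ) • w) := by
    have hadd (w w' : Fin 4 → ℝ) : AffR.tr w * AffR.tr w' = AffR.tr (w + w') := by
      ext <;> simp [AffR.tr]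
    have hneg (w : Fin 4 → ℝ) : (AffR.tr w)⁻¹ = AffR.tr (-w) := by
      ext <;> simp [AffR.tr]
    induction k using Int.induction_on with
    | zero => ext <;> simp [AffR.tr]
    | succ i ih =>
      rw [zpow_add_one, ih, hadd]
      push_cast
      rw [add_smul, one_smul]
    | pred i ih =>
      rw [zpow_sub_one, ih, hneg, hadd]
      push_cast
      rw [sub_smul, one_smul, sub_eq_add_neg]
  rw [c4, d4, hpow, hpow]
  ext i
  · fin_cases i <;> simp [AffR.tr]
  · simp [AffR.tr]

/-- Let `φ ∈ GL₄(ℝ)` with `(0,φ)·Γ·(0,φ)⁻¹ = Γ`. Then `φ` is a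
block-diagonal matrix `[[A,0],[0,B]]` with `A, B ∈ GL₂(ℤ)` (2×2 integer matrices of
determinant ±1); moreover `(0,φ)·f·(0,φ)⁻¹ = cᵏ dˡ f` for some integers `k, l`. -/
theorem linear_normalizer_of_bieberbach4 (phi : GL (Fin 4) ℝ)
    (hconj : Subgroup.map (MulAut.conj (⟨0, phi⟩ : AffR 4)).toMonoidHom Gamma4 = Gamma4) :
    (∃ A B : Matrix (Fin 2) (Fin 2) ℤ,
      (A.det = 1 ∨ A.det = -1) ∧ (B.det = 1 ∨ B.det = -1) ∧
      phi.val = !![(A 0 0 : ℝ), (A 0 1 : ℝ), 0, 0;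
                   (A 1 0 : ℝ), (A 1 1 : ℝ), 0, 0;
                   0, 0, (B 0 0 : ℝ), (B 0 1 : ℝ);
                   0, 0, (B 1 0 : ℝ), (B 1 1 : ℝ)]) ∧
    ∃ k l : ℤ,
      (⟨0, phi⟩ : AffR 4) * f4 * (⟨0, phi⟩ : AffR 4)⁻¹ = c4 ^ k * d4 ^ l * f4 := by
  have hfwd : ∀ x ∈ Gamma4, (⟨0, phi⟩ : AffR 4) * x * (⟨0, phi⟩ : AffR 4)⁻¹ ∈ Gamma4 := by
    intro x hx
    have hx' := Subgroup.mem_map_of_mem (MulAut.conj (⟨0, phi⟩ : AffR 4)).toMonoidHom hx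
    rw [hconj] at hx'
    simpa using hx'
  have hbwd : ∀ x ∈ Gamma4, (⟨0, phi⁻¹⟩ : AffR 4) * x * (⟨0, phi⁻¹⟩ : AffR 4)⁻¹ ∈ Gamma4 := by
    intro x hx
    have hinv : (⟨0, phi⁻¹⟩ : AffR 4) = (⟨0, phi⟩ : AffR 4)⁻¹ := by ext <;> simp
    rw [← hconj] at hx
    obtain ⟨y, hy, rfl⟩ := hx
    simpa [hinv, mul_assoc] using hy
  obtain ⟨Z, hZ⟩ := exists_int_entries_of_conj_mem phi hfwd
  obtain ⟨W, hW⟩ := exists_int_entries_of_conj_mem phi⁻¹ hbwd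
  have hf := hfwd f4 (Subgroup.subset_closure (by simp))
  rw [AffR.conj_linear] at hf
  obtain ⟨p, q, r, s, ⟨hm, -⟩ | ⟨hm, hv⟩⟩ := Gamma4_mem_form hf
  · exact absurd (by simpa [f4] using hm) LGL_ne_one
  dsimp only [f4] at hm hv
  have hcomm (i j : Fin 4) : (phi.val * LGL.val) i j = (LGL.val * phi.val) i j :=
    congrArg (fun g : GL (Fin 4) ℝ => g.val i j) (mul_inv_eq_iff_eq_mul.mp hm)
  simp only [LGL, Matrix.mul_apply, Fin.sum_univ_four] at hcomm
  have h02 : phi.val 0 2 = 0 := by have := hcomm 0 2; simp at this; linarith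
  have h03 : phi.val 0 3 = 0 := by have := hcomm 0 3; simp at this; linarith
  have h12 : phi.val 1 2 = 0 := by have := hcomm 1 2; simp at this; linarith
  have h13 : phi.val 1 3 = 0 := by have := hcomm 1 3; simp at this; linarith
  have h20 : phi.val 2 0 = 0 := by have := hcomm 2 0; simp at this; linarith
  have h21 : phi.val 2 1 = 0 := by have := hcomm 2 1; simp at this; linarith
  have h30 : phi.val 3 0 = 0 := by have := hcomm 3 0; simp at this; linarith
  have h31 : phi.val 3 1 = 0 := by have := hcomm 3 1; simp at this; linarith
  have hprod (i j : Fin 4) : (phi.val * phi⁻¹.val) i j = (1 : Matrix (Fin 4) (Fin 4) ℝ) i j := by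
    rw [phi.mul_inv]
  simp only [Matrix.mul_apply, Fin.sum_univ_four, hW] at hprod
  refine ⟨⟨!![Z 0 0, Z 0 1; Z 1 0, Z 1 1], !![Z 2 2, Z 2 3; Z 3 2, Z 3 3], ?_, ?_, ?_⟩, r, s, ?_⟩
  · apply Matrix.det_eq_one_or_neg_one_of_mul_eq_one (B := !![W 0 0, W 0 1; W 1 0, W 1 1])
    have e00 := hprod 0 0
    have e01 := hprod 0 1
    have e10 := hprod 1 0
    have e11 := hprod 1 1
    simp only [h02, h03, h12, h13] at e00 e01 e10 e11
    simp [hZ] at e00 e01 e10 e11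
    ext i j
    fin_cases i <;> fin_cases j <;> simp [Matrix.mul_apply]
    exacts [mod_cast e00, mod_cast e01, mod_cast e10, mod_cast e11]
  · apply Matrix.det_eq_one_or_neg_one_of_mul_eq_one (B := !![W 2 2, W 2 3; W 3 2, W 3 3])
    have e22 := hprod 2 2
    have e23 := hprod 2 3
    have e32 := hprod 3 2
    have e33 := hprod 3 3
    simp only [h20, h21, h30, h31] at e22 e23 e32 e33
    simp [hZ] at e22 e23 e32 e33
    ext i j
    fin_cases i <;> fin_cases j <;> simp [Matrix.mul_apply]
    exacts [mod_cast e22, mod_cast e23, mod_cast e32, mod_cast e33]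
  · ext i j
    fin_cases i <;> fin_cases j <;> simp [← hZ, h02, h03, h12, h13, h20, h21, h30, h31]
  · have h0 : phi.val.mulVec ![0, 0, 1 / 2, 1 / 2] 0 = 0 := by
      simp [Matrix.mulVec, dotProduct, Fin.sum_univ_four, h02, h03]
    have h1 : phi.val.mulVec ![0, 0, 1 / 2, 1 / 2] 1 = 0 := by
      simp [Matrix.mulVec, dotProduct, Fin.sum_univ_four, h12, h13]
    rw [hv] at h0 h1
    rw [AffR.conj_linear, c4_zpow_mul_d4_zpow]
    dsimp only [f4]
    rw [hv, hm]
    ext i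
    · fin_cases i
      · simpa [AffR.tr] using h0
      · simpa [AffR.tr] using h1
      · simp [AffR.tr]
      · simp [AffR.tr]
    · simp [AffR.tr]
end

section
/- For the 4-dimensional Bieberbach group Γ ≤ Aff(ℝ⁴): the derived subgroup is [Γ,Γ] = ⟨a², b²⟩, the center is Z(Γ) = ⟨c, d⟩, and the quotient Γ/(Z(Γ)·[Γ,Γ]) is isomorphic to ℤ/2ℤ ⊕ ℤ/2ℤ ⊕ ℤ/2ℤ, generated by the images of a, b and f. -/
/-- `a` as an element of `Γ`. -/
noncomputable def aG : ↥Gamma4 := ⟨a4, Subgroup.subset_closure (Set.mem_insert _ _)⟩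

/-- `b` as an element of `Γ`. -/
noncomputable def bG : ↥Gamma4 :=
  ⟨b4, Subgroup.subset_closure (Set.mem_insert_of_mem _ (Set.mem_insert _ _))⟩

/-- `c` as an element of `Γ`. -/
noncomputable def cG : ↥Gamma4 :=
  ⟨c4, Subgroup.subset_closure
    (Set.mem_insert_of_mem _ (Set.mem_insert_of_mem _ (Set.mem_insert _ _)))⟩

/-- `d` as an element of `Γ`. -/
noncomputable def dG : ↥Gamma4 :=
  ⟨d4, Subgroup.subset_closure
    (Set.mem_insert_of_mem _ (Set.mem_insert_of_mem _
      (Set.mem_insert_of_mem _ (Set.mem_insert _ _))))⟩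

/-- `f` as an element of `Γ`. -/
noncomputable def fG : ↥Gamma4 :=
  ⟨f4, Subgroup.subset_closure
    (Set.mem_insert_of_mem _ (Set.mem_insert_of_mem _
      (Set.mem_insert_of_mem _ (Set.mem_insert_of_mem _ rfl))))⟩

/-- The element with translation part `(i, j, p/2, q/2)` and linear part `L ^ p`. -/
noncomputable def affOfInt (i j p q : ℤ) : AffR 4 := ⟨![i, j, p / 2, q / 2], LGL ^ p⟩

theorem LGL_mul_self : LGL * LGL = 1 := by
  ext i j
  fin_cases i <;> fin_cases j <;>
    simp [LGL, Matrix.mul_apply, Fin.sum_univ_succ]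

theorem LGL_zpow_mulVec (p : ℤ) (x y z w : ℝ) :
    (LGL ^ p).val.mulVec ![x, y, z, w] =
      ![((p.negOnePow : ℤ) : ℝ) * x, ((p.negOnePow : ℤ) : ℝ) * y, z, w] := by
  rcases Int.even_or_odd' p with ⟨k, rfl | rfl⟩
  · rw [zpow_mul, zpow_two, LGL_mul_self, one_zpow]
    simp [Int.negOnePow_two_mul]
  · rw [zpow_add_one, zpow_mul, zpow_two, LGL_mul_self, one_zpow, one_mul,
      Int.negOnePow_two_mul_add_one]
    ext n
    fin_cases n <;> simp [LGL, Matrix.mulVec, dotProduct, Fin.sum_univ_succ]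

theorem affOfInt_mul (i j p q i' j' p' q' : ℤ) :
    affOfInt i j p q * affOfInt i' j' p' q' =
      affOfInt (i + p.negOnePow * i') (j + p.negOnePow * j') (p + p') (q + q') := by
  refine AffR.ext ?_ (zpow_add LGL p p').symm
  change ![(i : ℝ), j, p / 2, q / 2] + (LGL ^ p).val.mulVec ![(i' : ℝ), j', p' / 2, q' / 2] =
    ![((i + p.negOnePow * i' : ℤ) : ℝ), ((j + p.negOnePow * j' : ℤ) : ℝ),
      ((p + p' : ℤ) : ℝ) / 2, ((q + q' : ℤ) : ℝ) / 2]
  rw [LGL_zpow_mulVec]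
  ext n
  fin_cases n <;> simp <;> ring

theorem affOfInt_zero : affOfInt 0 0 0 0 = 1 := by
  refine AffR.ext ?_ (zpow_zero LGL)
  ext n
  fin_cases n <;> simp [affOfInt]

theorem affOfInt_inv (i j p q : ℤ) :
    (affOfInt i j p q)⁻¹ =
      affOfInt (-(p.negOnePow * i)) (-(p.negOnePow * j)) (-p) (-q) := by
  rw [inv_eq_iff_mul_eq_one, affOfInt_mul, ← affOfInt_zero]
  have h : (p.negOnePow : ℤ) * p.negOnePow = 1 := by
    rcases Int.units_eq_one_or p.negOnePow with h | h <;> simp [h]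
  congr 1
  · linear_combination (-i) * h
  · linear_combination (-j) * h
  · ring
  · ring

theorem affOfInt_inj {i j p q i' j' p' q' : ℤ} :
    affOfInt i j p q = affOfInt i' j' p' q' ↔ i = i' ∧ j = j' ∧ p = p' ∧ q = q' := by
  refine ⟨fun h => ?_, by rintro ⟨rfl, rfl, rfl, rfl⟩; rfl⟩
  have hv (n : Fin 4) := congrFun (congrArg AffR.v h) n
  have h0 := hv 0
  have h1 := hv 1
  have h2 := hv 2
  have h3 := hv 3
  simp only [affOfInt, Matrix.cons_val] at h0 h1 h2 h3
  refine ⟨by exact_mod_cast h0, by exact_mod_cast h1, ?_, ?_⟩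
  · have : (p : ℝ) = p' := by linarith
    exact_mod_cast this
  · have : (q : ℝ) = q' := by linarith
    exact_mod_cast this

theorem affOfInt_zpow (i j k l n : ℤ) :
    affOfInt i j (2 * k) (2 * l) ^ n =
      affOfInt (n * i) (n * j) (2 * (n * k)) (2 * (n * l)) := by
  induction n using Int.induction_on with
  | zero => simp [affOfInt_zero]
  | succ n ih =>
    rw [zpow_add_one, ih, affOfInt_mul, Int.negOnePow_two_mul]
    rw [Units.val_one, affOfInt_inj]
    exact ⟨by ring, by ring, by ring, by ring⟩
  | pred n ih =>
    rw [zpow_sub_one, ih, affOfInt_inv, affOfInt_mul]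
    simp only [Int.negOnePow_two_mul, Units.val_one, affOfInt_inj]
    exact ⟨by ring, by ring, by ring, by ring⟩

theorem a4_eq : a4 = affOfInt 1 0 0 0 := by
  refine AffR.ext ?_ (zpow_zero LGL).symm
  simp [a4, AffR.tr, affOfInt]

theorem b4_eq : b4 = affOfInt 0 1 0 0 := by
  refine AffR.ext ?_ (zpow_zero LGL).symm
  simp [b4, AffR.tr, affOfInt]

theorem c4_eq : c4 = affOfInt 0 0 2 0 := by
  refine AffR.ext ?_ ((zpow_two LGL).trans LGL_mul_self).symm
  simp [c4, AffR.tr, affOfInt]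

theorem d4_eq : d4 = affOfInt 0 0 0 2 := by
  refine AffR.ext ?_ (zpow_zero LGL).symm
  simp [d4, AffR.tr, affOfInt]

theorem f4_eq : f4 = affOfInt 0 0 1 1 := by
  refine AffR.ext ?_ (zpow_one LGL).symm
  simp [f4, affOfInt]

/-- Every element of `Γ` is of the form `affOfInt i j p q` with `p ≡ q (mod 2)`. -/
theorem exists_affOfInt (g : Gamma4) :
    ∃ i j p t : ℤ, (g : AffR 4) = affOfInt i j p (p + 2 * t) := by
  obtain ⟨g, hg⟩ := g
  change ∃ i j p t : ℤ, g = affOfInt i j p (p + 2 * t)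
  induction hg using Subgroup.closure_induction with
  | mem x hx =>
    rcases hx with rfl | rfl | rfl | rfl | rfl
    · exact ⟨1, 0, 0, 0, by simp [a4_eq]⟩
    · exact ⟨0, 1, 0, 0, by simp [b4_eq]⟩
    · exact ⟨0, 0, 2, -1, by simp [c4_eq]⟩
    · exact ⟨0, 0, 0, 1, by simp [d4_eq]⟩
    · exact ⟨0, 0, 1, 0, by simp [f4_eq]⟩
  | one => exact ⟨0, 0, 0, 0, by simp [affOfInt_zero]⟩
  | mul x y _ _ hx hy =>
    obtain ⟨i, j, p, t, rfl⟩ := hx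
    obtain ⟨i', j', p', t', rfl⟩ := hy
    refine ⟨i + p.negOnePow * i', j + p.negOnePow * j', p + p', t + t', ?_⟩
    rw [affOfInt_mul, affOfInt_inj]
    exact ⟨rfl, rfl, rfl, by ring⟩
  | inv x _ hx =>
    obtain ⟨i, j, p, t, rfl⟩ := hx
    refine ⟨-(p.negOnePow * i), -(p.negOnePow * j), -p, -t, ?_⟩
    rw [affOfInt_inv, affOfInt_inj]
    exact ⟨rfl, rfl, rfl, by ring⟩

theorem a4_sq_eq : a4 ^ 2 = affOfInt 2 0 0 0 := by
  simp [pow_two, a4_eq, affOfInt_mul]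

theorem b4_sq_eq : b4 ^ 2 = affOfInt 0 2 0 0 := by
  simp [pow_two, b4_eq, affOfInt_mul]

theorem zpow_mul_zpow_mem_closure_pair {G : Type*} [Group G] (x y : G) (m n : ℤ) :
    x ^ m * y ^ n ∈ Subgroup.closure {x, y} := by
  have hx : x ∈ Subgroup.closure {x, y} := Subgroup.subset_closure (by simp)
  have hy : y ∈ Subgroup.closure {x, y} := Subgroup.subset_closure (by simp)
  exact Subgroup.mul_mem _ (Subgroup.zpow_mem _ hx m) (Subgroup.zpow_mem _ hy n)

theorem mem_closure_sq_of_eq {g : Gamma4} {i j : ℤ}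
    (h : (g : AffR 4) = affOfInt (2 * i) (2 * j) 0 0) :
    g ∈ Subgroup.closure {aG ^ 2, bG ^ 2} := by
  suffices hg : (aG ^ 2) ^ i * (bG ^ 2) ^ j = g from
    hg ▸ zpow_mul_zpow_mem_closure_pair _ _ i j
  apply Subtype.ext
  change (a4 ^ 2) ^ i * (b4 ^ 2) ^ j = (g : AffR 4)
  have ha := affOfInt_zpow 2 0 0 0 i
  have hb := affOfInt_zpow 0 2 0 0 j
  simp only [mul_zero] at ha hb
  rw [h, a4_sq_eq, b4_sq_eq, ha, hb, affOfInt_mul]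
  simp [mul_comm]

theorem mem_closure_cd_of_eq {g : Gamma4} {k l : ℤ}
    (h : (g : AffR 4) = affOfInt 0 0 (2 * k) (2 * l)) :
    g ∈ Subgroup.closure {cG, dG} := by
  suffices hg : cG ^ k * dG ^ l = g from hg ▸ zpow_mul_zpow_mem_closure_pair _ _ k l
  apply Subtype.ext
  change c4 ^ k * d4 ^ l = (g : AffR 4)
  have hc := affOfInt_zpow 0 0 1 0 k
  have hd := affOfInt_zpow 0 0 0 1 l
  simp only [mul_zero, mul_one] at hc hd
  rw [h, c4_eq, d4_eq, hc, hd, affOfInt_mul]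
  simp

open scoped commutatorElement in
theorem commutator_Gamma4 :
    commutator Gamma4 = Subgroup.closure {aG ^ 2, bG ^ 2} := by
  apply le_antisymm
  · rw [commutator_def, Subgroup.commutator_le]
    rintro x - y -
    obtain ⟨i, j, p, t, hx⟩ := exists_affOfInt x
    obtain ⟨i', j', p', t', hy⟩ := exists_affOfInt y
    have key : ∃ m n : ℤ, ((⁅x, y⁆ : Gamma4) : AffR 4) = affOfInt (2 * m) (2 * n) 0 0 := by
      have hxy : ((⁅x, y⁆ : Gamma4) : AffR 4) = x * y * (x : AffR 4)⁻¹ * (y : AffR 4)⁻¹ := rfl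
      simp only [hxy, hx, hy, affOfInt_inv, affOfInt_mul, affOfInt_inj, Int.negOnePow_add,
        Int.negOnePow_neg, Units.val_mul]
      rcases Int.units_eq_one_or p.negOnePow with h | h <;>
        rcases Int.units_eq_one_or p'.negOnePow with h' | h' <;>
        simp only [h, h', Units.val_one, Units.val_neg]
      · exact ⟨0, 0, by ring, by ring, by ring, by ring⟩
      · exact ⟨i, j, by ring, by ring, by ring, by ring⟩
      · exact ⟨-i', -j', by ring, by ring, by ring, by ring⟩
      · exact ⟨i - i', j - j', by ring, by ring, by ring, by ring⟩
    obtain ⟨m, n, h⟩ := key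
    exact mem_closure_sq_of_eq h
  · rw [Subgroup.closure_le]
    have ha : aG ^ 2 = ⁅aG, fG⁆ := Subtype.ext <| by
      change a4 ^ 2 = a4 * f4 * a4⁻¹ * f4⁻¹
      rw [a4_sq_eq]
      simp [a4_eq, f4_eq, affOfInt_inv, affOfInt_mul]
    have hb : bG ^ 2 = ⁅bG, fG⁆ := Subtype.ext <| by
      change b4 ^ 2 = b4 * f4 * b4⁻¹ * f4⁻¹
      rw [b4_sq_eq]
      simp [b4_eq, f4_eq, affOfInt_inv, affOfInt_mul]
    rintro x (rfl | rfl)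
    · rw [ha]
      exact Subgroup.commutator_mem_commutator (Subgroup.mem_top _) (Subgroup.mem_top _)
    · rw [hb]
      exact Subgroup.commutator_mem_commutator (Subgroup.mem_top _) (Subgroup.mem_top _)

theorem center_Gamma4 : Subgroup.center Gamma4 = Subgroup.closure {cG, dG} := by
  apply le_antisymm
  · intro g hg
    rw [Subgroup.mem_center_iff] at hg
    obtain ⟨i, j, p, t, h⟩ := exists_affOfInt g
    have ha : a4 * g = g * a4 := congrArg Subtype.val (hg aG)
    have hf : f4 * g = g * f4 := congrArg Subtype.val (hg fG)
    rw [h, a4_eq, affOfInt_mul, affOfInt_mul, affOfInt_inj] at ha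
    rw [h, f4_eq, affOfInt_mul, affOfInt_mul, affOfInt_inj] at hf
    simp only [Int.negOnePow_zero, Int.negOnePow_one, Units.val_one, Units.val_neg] at ha hf
    have hi : i = 0 := by omega
    have hj : j = 0 := by omega
    have hp : p.negOnePow = 1 := Units.ext (by simp only [Units.val_one]; omega)
    obtain ⟨k, hk⟩ := (Int.negOnePow_eq_one_iff p).1 hp
    refine mem_closure_cd_of_eq (k := k) (l := k + t) ?_
    rw [h, hi, hj, hk, affOfInt_inj]
    refine ⟨rfl, rfl, by ring, by ring⟩
  · rw [Subgroup.closure_le]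
    rintro x (rfl | rfl) <;> rw [SetLike.mem_coe, Subgroup.mem_center_iff] <;> intro g <;>
      obtain ⟨i, j, p, t, h⟩ := exists_affOfInt g <;> apply Subtype.ext
    · change (g : AffR 4) * c4 = c4 * g
      rw [h, c4_eq, affOfInt_mul, affOfInt_mul, affOfInt_inj]
      simp [show Int.negOnePow 2 = 1 from Int.negOnePow_two_mul 1, add_comm]
    · change (g : AffR 4) * d4 = d4 * g
      rw [h, d4_eq, affOfInt_mul, affOfInt_mul, affOfInt_inj]
      simp [add_comm]

/-- The residues mod 2 of the integer coordinates `(i, j, p)` of an affine map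
`affOfInt i j p q`. -/
noncomputable def parity (x : AffR 4) : ZMod 2 × ZMod 2 × ZMod 2 :=
  (⌊x.v 0⌋, ⌊x.v 1⌋, ⌊2 * x.v 2⌋)

theorem parity_affOfInt (i j p q : ℤ) : parity (affOfInt i j p q) =
    ((i : ZMod 2), (j : ZMod 2), (p : ZMod 2)) := by
  have h : (2 : ℝ) * (p / 2) = p := by ring
  simp [parity, affOfInt, h]

/-- The reduction mod 2 of the coordinates, as a homomorphism on `Γ`. -/
noncomputable def parityHom : Gamma4 →* Multiplicative (ZMod 2 × ZMod 2 × ZMod 2) :=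
  MonoidHom.mk' (fun g => Multiplicative.ofAdd (parity g)) fun x y => by
    obtain ⟨i, j, p, t, hx⟩ := exists_affOfInt x
    obtain ⟨i', j', p', t', hy⟩ := exists_affOfInt y
    rw [← ofAdd_add, Subgroup.coe_mul, hx, hy, affOfInt_mul]
    simp [parity_affOfInt]

theorem parityHom_eq {g : Gamma4} {i j p q : ℤ} (h : (g : AffR 4) = affOfInt i j p q) :
    parityHom g = Multiplicative.ofAdd ((i : ZMod 2), (j : ZMod 2), (p : ZMod 2)) :=
  congrArg Multiplicative.ofAdd (by rw [h, parity_affOfInt])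

theorem parityHom_aG : parityHom aG = Multiplicative.ofAdd (1, 0, 0) := by
  simpa using parityHom_eq (g := aG) a4_eq

theorem parityHom_bG : parityHom bG = Multiplicative.ofAdd (0, 1, 0) := by
  simpa using parityHom_eq (g := bG) b4_eq

theorem parityHom_fG : parityHom fG = Multiplicative.ofAdd (0, 0, 1) := by
  simpa using parityHom_eq (g := fG) f4_eq

theorem parityHom_surjective : Function.Surjective parityHom := by
  intro z
  obtain ⟨x, y, w⟩ := z
  refine ⟨aG ^ x.val * bG ^ y.val * fG ^ w.val, ?_⟩
  simp only [map_mul, map_pow, parityHom_aG, parityHom_bG, parityHom_fG, ← ofAdd_nsmul,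
    ← ofAdd_add]
  apply congrArg Multiplicative.ofAdd
  simp

theorem ker_parityHom :
    parityHom.ker = Subgroup.center Gamma4 ⊔ commutator Gamma4 := by
  apply le_antisymm
  · intro g hg
    obtain ⟨i, j, p, t, h⟩ := exists_affOfInt g
    have h1 : ((i : ZMod 2), (j : ZMod 2), (p : ZMod 2)) = 0 :=
      Multiplicative.ofAdd.injective ((parityHom_eq h).symm.trans hg)
    simp only [Prod.mk_eq_zero, ZMod.intCast_zmod_eq_zero_iff_dvd _ 2] at h1
    obtain ⟨⟨i, rfl⟩, ⟨j, rfl⟩, ⟨p, rfl⟩⟩ := h1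
    rw [center_Gamma4, commutator_Gamma4]
    have hz : cG ^ p * dG ^ (p + t) ∈ Subgroup.closure {cG, dG} :=
      zpow_mul_zpow_mem_closure_pair _ _ _ _
    have hc := affOfInt_zpow 0 0 1 0 p
    have hd := affOfInt_zpow 0 0 0 1 (p + t)
    simp only [mul_zero, mul_one] at hc hd
    have hq : (cG ^ p * dG ^ (p + t))⁻¹ * g ∈ Subgroup.closure {aG ^ 2, bG ^ 2} := by
      refine mem_closure_sq_of_eq (i := i) (j := j) ?_
      change (c4 ^ p * d4 ^ (p + t))⁻¹ * (g : AffR 4) = _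
      rw [inv_mul_eq_iff_eq_mul, h, c4_eq, d4_eq, hc, hd, affOfInt_mul, affOfInt_mul,
        affOfInt_inj]
      simp [Int.negOnePow_two_mul, mul_add]
    simpa only [mul_inv_cancel_left] using Subgroup.mul_mem_sup hz hq
  · refine sup_le ?_ (Abelianization.commutator_subset_ker parityHom)
    rw [center_Gamma4, Subgroup.closure_le]
    rintro x (rfl | rfl)
    · exact (parityHom_eq (g := cG) c4_eq).trans (by decide)
    · exact (parityHom_eq (g := dG) d4_eq).trans (by decide)

/-- For the 4-dimensional Bieberbach group `Γ`: the derived subgroup is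
`[Γ,Γ] = ⟨a², b²⟩`, the center is `Z(Γ) = ⟨c, d⟩`, and `Γ/(Z(Γ)·[Γ,Γ]) ≅ ℤ/2 ⊕ ℤ/2 ⊕ ℤ/2`,
generated by the images of `a`, `b` and `f` (expressed here by a surjective homomorphism
`π` onto `(ℤ/2)³` with kernel `Z(Γ)·[Γ,Γ]` sending `a`, `b`, `f` to the generators). -/
theorem structure_of_bieberbach4 :
    commutator ↥Gamma4 = Subgroup.closure {aG ^ 2, bG ^ 2} ∧
    Subgroup.center ↥Gamma4 = Subgroup.closure {cG, dG} ∧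
    ∃ π : ↥Gamma4 →* Multiplicative (ZMod 2 × ZMod 2 × ZMod 2),
      Function.Surjective π ∧
      π.ker = Subgroup.center ↥Gamma4 ⊔ commutator ↥Gamma4 ∧
      π aG = Multiplicative.ofAdd (1, 0, 0) ∧
      π bG = Multiplicative.ofAdd (0, 1, 0) ∧
      π fG = Multiplicative.ofAdd (0, 0, 1) := by
  exact ⟨commutator_Gamma4, center_Gamma4, parityHom, parityHom_surjective, ker_parityHom,
    parityHom_aG, parityHom_bG, parityHom_fG⟩
end
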